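/- Let K be a field of arbitrary characteristic and let A be an affine line arrangement in K² with χ(A,t) = (t − n)(t − n − r), where n, r ∈ ℤ_{≥0} and r ≥ 2. Assume that A contains a free subarrangement B with exp₀(B) = (n − 2, n − 3). Then A is free if and only if n_H = n or n_H = n + r for some line H ∈ A. -/

import Mathlib

open MvPolynomial

variable {K : Type*} [Field K]

/-- A subset of `K × K` is an affine line: the zero set of a nonzero degree-one equation. -/
def IsAffineLine (L : Set (K × K)) : Prop :=
  ∃ a b c : K, (a, b) ≠ (0, 0) ∧ L = {p : K × K | a * p.1 + b * p.2 + c = 0}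

/-- An affine line arrangement: a finite set of affine lines in `K²`. -/
def IsLineArr (A : Finset (Set (K × K))) : Prop :=
  ∀ L ∈ A, IsAffineLine L

open Classical in
/-- The second Betti number `b₂(A)` of a line arrangement, via Whitney's theorem:
`b₂(A) = ∑ (-1)^{|B|}` over the subsets `B ⊆ A` with `|B| ≥ 2` and `⋂ B ≠ ∅`. -/
noncomputable def b2 (A : Finset (Set (K × K))) : ℤ :=
  ∑ B ∈ A.powerset.filter
      (fun B : Finset (Set (K × K)) => 2 ≤ B.card ∧ (⋂ L ∈ B, (L : Set (K × K))).Nonempty),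
    (-1 : ℤ) ^ B.card

/-- The characteristic polynomial `χ(A,t) = t² − |A|·t + b₂(A)`, evaluated at `t : ℂ`. -/
noncomputable def chi (A : Finset (Set (K × K))) (t : ℂ) : ℂ :=
  t ^ 2 - (A.card : ℂ) * t + (b2 A : ℂ)

/-- `nOn A H = |A ∩ H|`: the number of intersection points, lying on the line `H`, of `H`
with the lines of `A` other than `H`. -/
noncomputable def nOn (A : Finset (Set (K × K))) (H : Set (K × K)) : ℕ :=
  Set.ncard {p : K × K | p ∈ H ∧ ∃ L ∈ A, L ≠ H ∧ p ∈ L}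

/-- The linear form `a·x + b·y + c·z` in `K[x,y,z]`. -/
noncomputable def lin3 (a b c : K) : MvPolynomial (Fin 3) K :=
  C a * X 0 + C b * X 1 + C c * X 2

/-- The action on `f` of the derivation with coefficient vector `θ`. -/
noncomputable def applyDer3 (θ : Fin 3 → MvPolynomial (Fin 3) K)
    (f : MvPolynomial (Fin 3) K) : MvPolynomial (Fin 3) K :=
  ∑ i, θ i * pderiv i f

/-- `θ` belongs to `D(cA)`, the logarithmic derivation module of the cone of `A`:
`θ(α_H) ∈ S·α_H` for every `H ∈ cA`, where `cA` consists of the homogenizations of the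
lines of `A` together with the plane `z = 0`. -/
def InDCone (A : Finset (Set (K × K))) (θ : Fin 3 → MvPolynomial (Fin 3) K) : Prop :=
  (∀ L ∈ A, ∀ a b c : K, (a, b) ≠ (0, 0) →
      L = {p : K × K | a * p.1 + b * p.2 + c = 0} →
      ∃ g, applyDer3 θ (lin3 a b c) = g * lin3 a b c) ∧
  (∃ g, applyDer3 θ (X 2) = g * (X 2 : MvPolynomial (Fin 3) K))

/-- A homogeneous derivation of degree `d` on `K[x,y,z]`. -/
def HomogDer3 (θ : Fin 3 → MvPolynomial (Fin 3) K) (d : ℕ) : Prop :=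
  ∀ i, (θ i).IsHomogeneous d

/-- `A` is free with exponents `exp₀(A) = (d₁, d₂)`: `D(cA)` is a free module with a
homogeneous basis consisting of the Euler derivation `x∂ₓ + y∂_y + z∂_z` and two
derivations of degrees `d₁` and `d₂`. -/
def IsFreeExp (A : Finset (Set (K × K))) (d₁ d₂ : ℕ) : Prop :=
  ∃ θ₁ θ₂ : Fin 3 → MvPolynomial (Fin 3) K,
    InDCone A θ₁ ∧ InDCone A θ₂ ∧ HomogDer3 θ₁ d₁ ∧ HomogDer3 θ₂ d₂ ∧
    ∀ θ : Fin 3 → MvPolynomial (Fin 3) K, InDCone A θ →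
      ∃! cfs : MvPolynomial (Fin 3) K × MvPolynomial (Fin 3) K × MvPolynomial (Fin 3) K,
        θ = fun j => cfs.1 * X j + cfs.2.1 * θ₁ j + cfs.2.2 * θ₂ j

/-- `A` is free (with some exponents). -/
def IsFree (A : Finset (Set (K × K))) : Prop := ∃ d₁ d₂ : ℕ, IsFreeExp A d₁ d₂

/-- `A` is free with (integer-valued) exponents `exp₀(A) = (d₁, d₂)`. -/
def IsFreeExpZ (A : Finset (Set (K × K))) (d₁ d₂ : ℤ) : Prop :=
  ∃ e₁ e₂ : ℕ, (e₁ : ℤ) = d₁ ∧ (e₂ : ℤ) = d₂ ∧ IsFreeExp A e₁ e₂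

section Homogeneous

variable {σ : Type*}

theorem homogeneousComponent_mul_of_isHomogeneous {p : MvPolynomial σ K} {k : ℕ}
    (hp : p.IsHomogeneous k) (q : MvPolynomial σ K) (d : ℕ) :
    homogeneousComponent (d + k) (p * q) = p * homogeneousComponent d q := by
  conv_lhs => rw [← sum_homogeneousComponent q]
  rw [Finset.mul_sum, map_sum]
  have h : ∀ i, homogeneousComponent (d + k) (p * homogeneousComponent i q) =
      if d = i then p * homogeneousComponent i q else 0 := by
    intro i
    rw [homogeneousComponent_of_mem (n := i + k)]
    · simp
    · rw [add_comm]
      exact hp.mul (homogeneousComponent_isHomogeneous i q)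
  simp_rw [h]
  rw [Finset.sum_ite_eq]
  split_ifs with hd
  · rfl
  · rw [homogeneousComponent_eq_zero, mul_zero]
    simpa using hd

theorem homogeneousComponent_mul_of_lt {p : MvPolynomial σ K} {k d : ℕ}
    (hp : p.IsHomogeneous k) (q : MvPolynomial σ K) (hd : d < k) :
    homogeneousComponent d (p * q) = 0 := by
  rw [← sum_homogeneousComponent q, Finset.mul_sum, map_sum]
  refine Finset.sum_eq_zero fun i _ => ?_
  rw [homogeneousComponent_of_mem (n := k + i)
    (hp.mul (homogeneousComponent_isHomogeneous i q)), if_neg (by omega)]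

theorem MvPolynomial.IsHomogeneous.dvd_homogeneousComponent {p q : MvPolynomial σ K} {k : ℕ}
    (hp : p.IsHomogeneous k) (h : p ∣ q) (d : ℕ) : p ∣ homogeneousComponent d q := by
  obtain ⟨u, rfl⟩ := h
  rcases lt_or_ge d k with hd | hd
  · simp [homogeneousComponent_mul_of_lt hp u hd]
  · obtain ⟨e, rfl⟩ := Nat.exists_eq_add_of_le' hd
    rw [homogeneousComponent_mul_of_isHomogeneous hp]
    exact dvd_mul_right _ _

theorem MvPolynomial.IsHomogeneous.of_mul_left {p q : MvPolynomial σ K} {k d : ℕ}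
    (hp : p.IsHomogeneous k) (hp0 : p ≠ 0) (h : (p * q).IsHomogeneous (d + k)) :
    q.IsHomogeneous d := by
  have := homogeneousComponent_mul_of_isHomogeneous hp q d
  rw [homogeneousComponent_eq_self h] at this
  rw [mul_left_cancel₀ hp0 this]
  exact homogeneousComponent_isHomogeneous d q

theorem MvPolynomial.IsHomogeneous.eq_zero_of_mul_of_lt {p q : MvPolynomial σ K} {k d : ℕ}
    (hp : p.IsHomogeneous k) (h : (p * q).IsHomogeneous d) (hd : d < k) :
    p * q = 0 := by
  rw [← homogeneousComponent_eq_self h, homogeneousComponent_mul_of_lt hp q hd]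

instance finite_homogeneousSubmodule [Finite σ] (d : ℕ) :
    Module.Finite K (homogeneousSubmodule σ K d) :=
  Module.Finite.iff_fg.mpr (homogeneousSubmodule_fg σ K d)

theorem finrank_homogeneousSubmodule_fin_three (d : ℕ) :
    Module.finrank K (homogeneousSubmodule (Fin 3) K d) = (d + 2).choose 2 := by
  classical
  let s := (Finset.univ : Finset (Fin 3)).finsuppAntidiag d
  have hs : ∀ m : Fin 3 →₀ ℕ, m ∈ s ↔ m.degree = d := by
    intro m
    simp [s, Finset.mem_finsuppAntidiag, Finsupp.degree_eq_sum]
  let f : homogeneousSubmodule (Fin 3) K d →ₗ[K] (s → K) :=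
    LinearMap.pi fun m => (lcoeff K m.1).comp (Submodule.subtype _)
  have hf : Function.Bijective f := by
    constructor
    · rw [← LinearMap.ker_eq_bot, LinearMap.ker_eq_bot']
      rintro ⟨p, hp⟩ h
      ext m
      by_cases hm : m.degree = d
      · exact congrFun h ⟨m, (hs m).2 hm⟩
      · simpa using IsHomogeneous.coeff_eq_zero hp hm
    · intro g
      refine ⟨⟨∑ m : s, monomial m.1 (g m), ?_⟩, ?_⟩
      · exact Submodule.sum_mem _ fun m _ => isHomogeneous_monomial _ ((hs _).1 m.2)
      · ext m
        simp [f, coeff_monomial]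
  rw [(LinearEquiv.ofBijective f hf).finrank_eq, Module.finrank_fintype_fun_eq_card,
    Fintype.card_coe, Finset.card_finsuppAntidiag_nat_eq_choose]
  simp only [Finset.card_univ, Fintype.card_fin]
  rw [show 3 + d - 1 = d + 2 by omega, Nat.choose_symm_add]

end Homogeneous

/-- An equation `a x + b y + c = 0` of an affine line, together with a linear form `a₂ x + b₂ y`
which restricts to a coordinate on it. -/
structure LineFrame (K : Type*) [Field K] where
  /-- The coefficient of `x` in the equation. -/
  a : K
  /-- The coefficient of `y` in the equation. -/
  b : K
  /-- The constant coefficient of the equation. -/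
  c : K
  /-- The coefficient of `x` in the coordinate. -/
  a₂ : K
  /-- The coefficient of `y` in the coordinate. -/
  b₂ : K
  det : a₂ * b - b₂ * a = 1

theorem aeval_mul_of_isHomogeneous {σ R : Type*} [CommRing R] [Algebra K R]
    {p : MvPolynomial σ K} {d : ℕ} (hp : p.IsHomogeneous d) (z : R) (u : σ → R) :
    aeval (fun i => z * u i) p = z ^ d * aeval u p := by
  rw [aeval_def, aeval_def, eval₂_eq, eval₂_eq, Finset.mul_sum]
  refine Finset.sum_congr rfl fun m hm => ?_
  have hd := hp.degree_eq_sum_deg_support hm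
  simp_rw [mul_pow, Finset.prod_mul_distrib, Finset.prod_pow_eq_pow_sum]
  rw [← hd]
  ring

theorem exists_smul_of_forall_line {a b c a₁ b₁ c₁ : K} (h0 : (a, b) ≠ (0, 0))
    (h : ∀ p : K × K, a * p.1 + b * p.2 + c = 0 → a₁ * p.1 + b₁ * p.2 + c₁ = 0) :
    ∃ u, a₁ = u * a ∧ b₁ = u * b ∧ c₁ = u * c := by
  by_cases hb : b = 0
  · have ha : a ≠ 0 := by
      rintro rfl
      exact h0 (by rw [hb])
    have h1 := h (-c / a, 0) (by simp only [hb]; field_simp; ring)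
    have h2 := h (-c / a, 1) (by simp only [hb]; field_simp; ring)
    simp only at h1 h2
    refine ⟨a₁ / a, by field_simp, ?_, ?_⟩
    · rw [hb]
      linear_combination h2 - h1
    · linear_combination h1
  · have h1 := h (0, -c / b) (by field_simp; ring)
    have h2 := h (1, -(a + c) / b) (by field_simp; ring)
    simp only at h1 h2
    refine ⟨b₁ / b, ?_, by field_simp, ?_⟩
    · field_simp at h1 h2 ⊢
      linear_combination h2 - h1
    · linear_combination h1

theorem lin3_isHomogeneous (a b c : K) : (lin3 a b c).IsHomogeneous 1 :=
  ((isHomogeneous_C_mul_X _ _).add (isHomogeneous_C_mul_X _ _)).add (isHomogeneous_C_mul_X _ _)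

theorem coeff_lin3_zero (a b c : K) : coeff (Finsupp.single 0 1) (lin3 a b c) = a := by
  simp [lin3, coeff_X, coeff_C_mul, Finsupp.single_left_inj]

theorem coeff_lin3_one (a b c : K) : coeff (Finsupp.single 1 1) (lin3 a b c) = b := by
  simp [lin3, coeff_X, coeff_C_mul, Finsupp.single_left_inj]

namespace LineFrame

variable (F G : LineFrame K)

/-- The affine line described by a frame. -/
def carrier : Set (K × K) := {p | F.a * p.1 + F.b * p.2 + F.c = 0}

/-- The homogenized equation of the line. -/
noncomputable def form : MvPolynomial (Fin 3) K := lin3 F.a F.b F.c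

/-- The component of a vector field normal to the line. -/
noncomputable def normal :
    MvPolynomial (Fin 3) K × MvPolynomial (Fin 3) K →ₗ[MvPolynomial (Fin 3) K]
      MvPolynomial (Fin 3) K :=
  (C F.a : MvPolynomial (Fin 3) K) • LinearMap.fst (MvPolynomial (Fin 3) K)
      (MvPolynomial (Fin 3) K) (MvPolynomial (Fin 3) K) +
    (C F.b : MvPolynomial (Fin 3) K) • LinearMap.snd (MvPolynomial (Fin 3) K)
      (MvPolynomial (Fin 3) K) (MvPolynomial (Fin 3) K)

/-- The component of a vector field along the line. -/
noncomputable def tangent :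
    MvPolynomial (Fin 3) K × MvPolynomial (Fin 3) K →ₗ[MvPolynomial (Fin 3) K]
      MvPolynomial (Fin 3) K :=
  (C F.a₂ : MvPolynomial (Fin 3) K) • LinearMap.fst (MvPolynomial (Fin 3) K)
      (MvPolynomial (Fin 3) K) (MvPolynomial (Fin 3) K) +
    (C F.b₂ : MvPolynomial (Fin 3) K) • LinearMap.snd (MvPolynomial (Fin 3) K)
      (MvPolynomial (Fin 3) K) (MvPolynomial (Fin 3) K)

/-- Restriction of a polynomial to the line, in the chart `z = 1`. -/
noncomputable def res : MvPolynomial (Fin 3) K →ₐ[K] Polynomial K :=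
  aeval ![Polynomial.C (F.c * F.b₂) + Polynomial.C F.b * Polynomial.X,
    Polynomial.C (-(F.c * F.a₂)) - Polynomial.C F.a * Polynomial.X, 1]

theorem normal_apply (θ : MvPolynomial (Fin 3) K × MvPolynomial (Fin 3) K) :
    F.normal θ = C F.a * θ.1 + C F.b * θ.2 := rfl

theorem tangent_apply (θ : MvPolynomial (Fin 3) K × MvPolynomial (Fin 3) K) :
    F.tangent θ = C F.a₂ * θ.1 + C F.b₂ * θ.2 := rfl

theorem coeff_ne_zero : (F.a, F.b) ≠ (0, 0) := by
  intro h
  have := F.det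
  simp only [Prod.mk.injEq] at h
  simp [h.1, h.2] at this

theorem isHomogeneous_form : F.form.IsHomogeneous 1 := lin3_isHomogeneous _ _ _

theorem form_ne_zero : F.form ≠ 0 := by
  intro h
  apply F.coeff_ne_zero
  have ha := coeff_lin3_zero F.a F.b F.c
  have hb := coeff_lin3_one F.a F.b F.c
  rw [form] at h
  rw [h, coeff_zero] at ha hb
  rw [← ha, ← hb]

theorem irreducible_form : Irreducible F.form := by
  refine irreducible_of_totalDegree_eq_one (F.isHomogeneous_form.totalDegree F.form_ne_zero) ?_
  intro x hx
  rw [isUnit_iff_ne_zero]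
  rintro rfl
  apply F.form_ne_zero
  ext m
  simpa using hx m

theorem isRelPrime_form (h : F.carrier ≠ G.carrier) : IsRelPrime F.form G.form := by
  rw [F.irreducible_form.isRelPrime_iff_not_dvd]
  rintro ⟨u, hu⟩
  have key : ∀ p : K × K, F.a * p.1 + F.b * p.2 + F.c = 0 →
      G.a * p.1 + G.b * p.2 + G.c = 0 := by
    intro p hp
    have := congrArg (MvPolynomial.eval ![p.1, p.2, 1]) hu
    simpa [form, lin3, hp] using this
  obtain ⟨v, h1, h2, h3⟩ := exists_smul_of_forall_line F.coeff_ne_zero key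
  have hv : v ≠ 0 := by
    rintro rfl
    exact G.coeff_ne_zero (by simp [h1, h2])
  apply h
  ext p
  simp only [carrier, Set.mem_ofPred_eq, h1, h2, h3]
  rw [show v * F.a * p.1 + v * F.b * p.2 + v * F.c = v * (F.a * p.1 + F.b * p.2 + F.c) by ring]
  simp [hv]

theorem res_X_zero :
    F.res (X 0) = Polynomial.C (F.c * F.b₂) + Polynomial.C F.b * Polynomial.X := by
  simp [res]

theorem res_X_one :
    F.res (X 1) = Polynomial.C (-(F.c * F.a₂)) - Polynomial.C F.a * Polynomial.X := by
  simp [res]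

theorem res_X_two : F.res (X 2) = 1 := by
  simp [res]

theorem res_C (r : K) : F.res (C r) = Polynomial.C r := by
  simp [res]

theorem res_lin3 (a b c : K) : F.res (lin3 a b c) =
    Polynomial.C (a * F.b - b * F.a) * Polynomial.X +
      Polynomial.C (F.c * (a * F.b₂ - b * F.a₂) + c) := by
  simp only [lin3, map_add, map_mul, res_C, res_X_zero, res_X_one, res_X_two, map_sub, map_neg]
  ring

theorem res_form : F.res F.form = 0 := by
  have h := F.det
  rw [form, res_lin3, mul_comm F.b, sub_self,
    show F.c * (F.a * F.b₂ - F.b * F.a₂) + F.c = 0 by linear_combination (-F.c) * h]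
  simp

theorem natDegree_res_le {p : MvPolynomial (Fin 3) K} {d : ℕ} (hp : p.IsHomogeneous d) :
    (F.res p).natDegree ≤ d := by
  refine (aeval_natDegree_le (n := 1) p hp.totalDegree_le _ fun i => ?_).trans_eq (mul_one d)
  fin_cases i
  · exact Polynomial.natDegree_add_le_of_degree_le
      ((Polynomial.natDegree_C _).trans_le zero_le_one)
      ((Polynomial.natDegree_C_mul_le _ _).trans Polynomial.natDegree_X_le)
  · exact (Polynomial.natDegree_sub_le _ _).trans (max_le
      ((Polynomial.natDegree_C _).trans_le zero_le_one)
      ((Polynomial.natDegree_C_mul_le _ _).trans Polynomial.natDegree_X_le))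
  · simp

theorem exists_res_eq {q : Polynomial K} {d : ℕ} (hq : q.natDegree ≤ d) :
    ∃ p : MvPolynomial (Fin 3) K, p.IsHomogeneous d ∧ F.res p = q := by
  refine ⟨∑ i ∈ Finset.range (d + 1), C (q.coeff i) * (lin3 F.a₂ F.b₂ 0 ^ i * X 2 ^ (d - i)),
    ?_, ?_⟩
  · refine IsHomogeneous.sum _ _ _ fun i hi => IsHomogeneous.C_mul ?_ _
    have h1 := ((lin3_isHomogeneous F.a₂ F.b₂ 0).pow i).mul
      ((isHomogeneous_X K (2 : Fin 3)).pow (d - i))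
    have hi' := Finset.mem_range.1 hi
    rwa [show 1 * i + 1 * (d - i) = d by omega] at h1
  · have h : F.res (lin3 F.a₂ F.b₂ 0) = Polynomial.X := by
      rw [res_lin3, F.det, mul_comm F.b₂]
      simp
    simp only [map_sum, map_mul, map_pow, res_C, h, res_X_two, one_pow, mul_one]
    exact (q.as_sum_range_C_mul_X_pow' (Nat.lt_succ_of_le hq)).symm

theorem form_dvd_of_res_eq_zero {p : MvPolynomial (Fin 3) K} {d : ℕ} (hp : p.IsHomogeneous d)
    (h : F.res p = 0) : F.form ∣ p := by
  have hdet := F.det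
  let t : MvPolynomial (Fin 3) K := C F.a₂ * X 0 + C F.b₂ * X 1
  let ψ : MvPolynomial (Fin 3) K →ₐ[K] MvPolynomial (Fin 3) K :=
    aeval ![C (F.c * F.b₂) * X 2 + C F.b * t, C (-(F.c * F.a₂)) * X 2 - C F.a * t, X 2]
  have hψ : F.form ∣ p - ψ p := by
    rw [← Ideal.mem_span_singleton, ← Ideal.Quotient.eq]
    have hext : (Ideal.Quotient.mkₐ K (Ideal.span {F.form})) =
        (Ideal.Quotient.mkₐ K (Ideal.span {F.form})).comp ψ := by
      refine MvPolynomial.algHom_ext fun i => ?_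
      simp only [AlgHom.comp_apply, Ideal.Quotient.mkₐ_eq_mk]
      rw [Ideal.Quotient.eq, Ideal.mem_span_singleton]
      have hC : C F.a₂ * C F.b - C F.b₂ * C F.a = (1 : MvPolynomial (Fin 3) K) := by
        rw [← map_mul, ← map_mul, ← map_sub, hdet, map_one]
      fin_cases i
      · refine ⟨-C F.b₂, ?_⟩
        simp only [ψ, t, form, lin3, aeval_X, map_mul]
        simp
        linear_combination (-X 0) * hC
      · refine ⟨C F.a₂, ?_⟩
        simp only [ψ, t, form, lin3, aeval_X, map_mul]
        simp
        linear_combination (-X 1) * hC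
      · simp [ψ]
    exact congrArg (fun f => f p) hext
  have hz :
      algebraMap (MvPolynomial (Fin 3) K) (FractionRing (MvPolynomial (Fin 3) K)) (X 2) ≠ 0 := by
    simp
  have h0 : ψ p = 0 := by
    apply IsFractionRing.injective (MvPolynomial (Fin 3) K)
      (FractionRing (MvPolynomial (Fin 3) K))
    rw [map_zero]
    let ι : MvPolynomial (Fin 3) K →ₐ[K] FractionRing (MvPolynomial (Fin 3) K) :=
      IsScalarTower.toAlgHom K (MvPolynomial (Fin 3) K) _
    let s := ι t / ι (X 2)
    have hz' : ι (X 2) ≠ 0 := hz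
    have h1 : ι.comp ψ = aeval (fun i => ι (X 2) * (Polynomial.aeval s) (F.res (X i))) := by
      refine MvPolynomial.algHom_ext fun i => ?_
      rw [AlgHom.comp_apply, aeval_X]
      have hs : ι (X 2) * s = ι t := by
        simp only [s]
        field_simp
      have hCι : ∀ r : K, ι (C r) = algebraMap K _ r := fun r => by
        rw [← MvPolynomial.algebraMap_eq, AlgHom.commutes]
      fin_cases i
      · simp [res_X_zero, hCι]
        linear_combination (-algebraMap K _ F.b) * hs
      · simp [res_X_one, hCι]
        linear_combination (algebraMap K _ F.a) * hs
      · simp [res_X_two]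
    have h2 : (Polynomial.aeval s).comp F.res =
        aeval (fun i => (Polynomial.aeval s) (F.res (X i))) := by
      refine MvPolynomial.algHom_ext fun i => ?_
      simp
    change (ι.comp ψ) p = 0
    rw [h1, aeval_mul_of_isHomogeneous hp, ← h2, AlgHom.comp_apply, h, map_zero, mul_zero]
  simpa [h0] using hψ

theorem res_eq_zero_of_normal_tangent
    {θ : MvPolynomial (Fin 3) K × MvPolynomial (Fin 3) K}
    (hn : F.res (F.normal θ) = 0) (ht : F.res (F.tangent θ) = 0) :
    F.res θ.1 = 0 ∧ F.res θ.2 = 0 := by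
  have hdet := congrArg Polynomial.C F.det
  simp only [normal_apply, tangent_apply, map_add, map_mul, res_C, map_sub, map_one] at hn ht hdet
  constructor
  · linear_combination (-F.res θ.1) * hdet + Polynomial.C F.b * ht - Polynomial.C F.b₂ * hn
  · linear_combination (-F.res θ.2) * hdet + Polynomial.C F.a₂ * hn - Polynomial.C F.a * ht

end LineFrame

namespace LineFrame

variable (F G : LineFrame K)

/-- The determinant of the linear parts of two frames, vanishing for parallel lines. -/
def cross : K := G.a * F.b - G.b * F.a

/-- The coordinate along `F` of the intersection point with a non-parallel line. -/
noncomputable def meet : K := -(F.c * (G.a * F.b₂ - G.b * F.a₂) + G.c) / F.cross G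

/-- The point of the line with a given coordinate. -/
def point (t : K) : K × K := (F.c * F.b₂ + F.b * t, -(F.c * F.a₂) - F.a * t)

theorem point_injective : Function.Injective F.point := by
  intro s t h
  have hdet := F.det
  simp only [point, Prod.mk.injEq] at h
  linear_combination F.a₂ * h.1 + F.b₂ * h.2 + (t - s) * hdet

theorem point_mem_carrier (t : K) : F.point t ∈ F.carrier := by
  have hdet := F.det
  simp only [point, carrier, Set.mem_ofPred_eq]
  linear_combination (-F.c) * hdet

theorem exists_point_eq {p : K × K} (hp : p ∈ F.carrier) : ∃ t, F.point t = p := by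
  have hdet := F.det
  simp only [carrier, Set.mem_ofPred_eq] at hp
  refine ⟨F.a₂ * p.1 + F.b₂ * p.2, Prod.ext ?_ ?_⟩
  · simp only [point]
    linear_combination p.1 * hdet + F.b₂ * hp
  · simp only [point]
    linear_combination p.2 * hdet - F.a₂ * hp

theorem res_form_of_cross_ne_zero (h : F.cross G ≠ 0) :
    F.res G.form = Polynomial.C (F.cross G) * (Polynomial.X - Polynomial.C (F.meet G)) := by
  have h1 : F.cross G * F.meet G = -(F.c * (G.a * F.b₂ - G.b * F.a₂) + G.c) :=
    mul_div_cancel₀ _ h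
  rw [form, res_lin3, mul_sub (Polynomial.C (F.cross G)), ← Polynomial.C_mul, h1, cross,
    Polynomial.C_neg, sub_neg_eq_add]

theorem exists_res_form_eq_C (hFG : F.carrier ≠ G.carrier) (h : F.cross G = 0) :
    ∃ u : K, u ≠ 0 ∧ F.res G.form = Polynomial.C u := by
  refine ⟨F.c * (G.a * F.b₂ - G.b * F.a₂) + G.c, ?_, ?_⟩
  · intro h0
    have hr : F.res G.form = 0 := by
      rw [form, res_lin3, h0, ← cross, h]
      simp
    exact (F.irreducible_form.isRelPrime_iff_not_dvd.1 (F.isRelPrime_form G hFG))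
      (F.form_dvd_of_res_eq_zero G.isHomogeneous_form hr)
  · rw [form, res_lin3, ← cross, h]
    simp

theorem eval_res_form (t : K) :
    (F.res G.form).eval t = G.a * (F.point t).1 + G.b * (F.point t).2 + G.c := by
  rw [form, res_lin3]
  simp only [point, Polynomial.eval_add, Polynomial.eval_mul, Polynomial.eval_C,
    Polynomial.eval_X]
  ring

theorem point_mem_carrier_iff (hFG : F.carrier ≠ G.carrier) (t : K) :
    F.point t ∈ G.carrier ↔ F.cross G ≠ 0 ∧ F.meet G = t := by
  have h0 : F.point t ∈ G.carrier ↔ (F.res G.form).eval t = 0 := by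
    rw [eval_res_form]
    rfl
  rw [h0]
  by_cases h : F.cross G = 0
  · obtain ⟨u, hu, he⟩ := F.exists_res_form_eq_C G hFG h
    simp [he, hu, h]
  · rw [F.res_form_of_cross_ne_zero G h]
    simp only [Polynomial.eval_mul, Polynomial.eval_C, Polynomial.eval_sub, Polynomial.eval_X,
      mul_eq_zero, h, false_or, ne_eq, not_false_eq_true, true_and, sub_eq_zero]
    exact eq_comm

/-- The restriction to the line of the tangent component. -/
noncomputable def tangentRes :
    MvPolynomial (Fin 3) K × MvPolynomial (Fin 3) K →ₗ[K] Polynomial K :=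
  F.res.toLinearMap ∘ₗ F.tangent.restrictScalars K

/-- The restriction to the line of the normal component. -/
noncomputable def normalRes :
    MvPolynomial (Fin 3) K × MvPolynomial (Fin 3) K →ₗ[K] Polynomial K :=
  F.res.toLinearMap ∘ₗ F.normal.restrictScalars K

theorem tangentRes_apply (θ : MvPolynomial (Fin 3) K × MvPolynomial (Fin 3) K) :
    F.tangentRes θ = F.res (F.tangent θ) := rfl

theorem normalRes_apply (θ : MvPolynomial (Fin 3) K × MvPolynomial (Fin 3) K) :
    F.normalRes θ = F.res (F.normal θ) := rfl

theorem isHomogeneous_normal {θ : MvPolynomial (Fin 3) K × MvPolynomial (Fin 3) K} {d : ℕ}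
    (h₁ : θ.1.IsHomogeneous d) (h₂ : θ.2.IsHomogeneous d) : (F.normal θ).IsHomogeneous d :=
  (h₁.C_mul _).add (h₂.C_mul _)

theorem isHomogeneous_tangent {θ : MvPolynomial (Fin 3) K × MvPolynomial (Fin 3) K} {d : ℕ}
    (h₁ : θ.1.IsHomogeneous d) (h₂ : θ.2.IsHomogeneous d) : (F.tangent θ).IsHomogeneous d :=
  (h₁.C_mul _).add (h₂.C_mul _)

theorem res_normal_of_normalRes_eq_zero {θ : MvPolynomial (Fin 3) K × MvPolynomial (Fin 3) K}
    (h : F.normalRes θ = 0) : F.res (G.normal θ) = Polynomial.C (F.cross G) * F.tangentRes θ := by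
  have hdet := congrArg Polynomial.C F.det
  simp only [normalRes_apply, tangentRes_apply, normal_apply, tangent_apply, map_add, map_mul,
    res_C, map_sub, map_one, cross] at h hdet ⊢
  linear_combination
    (-(Polynomial.C G.a * F.res θ.1 + Polynomial.C G.b * F.res θ.2)) * hdet +
    (Polynomial.C G.b * Polynomial.C F.a₂ - Polynomial.C G.a * Polynomial.C F.b₂) * h

/-- A field tangent to lines through a point is, after wedging with the radial field at that
point, divisible by their equations. -/
theorem form_dvd_wedge {θ : MvPolynomial (Fin 3) K × MvPolynomial (Fin 3) K} {p : K × K}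
    (hp : p ∈ G.carrier) (h : G.form ∣ G.normal θ) :
    G.form ∣ (X 0 - C p.1 * X 2) * θ.2 - (X 1 - C p.2 * X 2) * θ.1 := by
  obtain ⟨u, hu⟩ := h
  have hdet := congrArg (C : K → MvPolynomial (Fin 3) K) G.det
  have hp' := congrArg (C : K → MvPolynomial (Fin 3) K) hp
  simp only [form, lin3, normal_apply, map_add, map_mul, map_sub, map_one, map_zero] at hu hdet hp'
  refine ⟨C G.a₂ * ((X 0 - C p.1 * X 2) * u - θ.1) - C G.b₂ * (θ.2 - (X 1 - C p.2 * X 2) * u), ?_⟩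
  simp only [form, lin3]
  linear_combination
    (-((X 0 - C p.1 * X 2) * θ.2 - (X 1 - C p.2 * X 2) * θ.1)) * hdet +
    (C G.a₂ * (X 0 - C p.1 * X 2) + C G.b₂ * (X 1 - C p.2 * X 2)) * hu +
    (C G.a₂ * θ.1 + C G.b₂ * θ.2) * X 2 * hp'

theorem res_wedge (θ : MvPolynomial (Fin 3) K × MvPolynomial (Fin 3) K) (t : K) :
    F.res ((X 0 - C (F.point t).1 * X 2) * θ.2 - (X 1 - C (F.point t).2 * X 2) * θ.1) =
      (Polynomial.X - Polynomial.C t) * F.normalRes θ := by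
  simp only [normalRes_apply, normal_apply, point, map_sub, map_mul, map_add, map_neg, res_X_zero,
    res_X_one, res_X_two, res_C]
  ring

theorem form_dvd_normal_of_cross_eq_zero {θ : MvPolynomial (Fin 3) K × MvPolynomial (Fin 3) K}
    (h0 : F.cross G = 0) (h : G.form ∣ G.normal θ) : G.form ∣ F.normal θ := by
  have hdet := F.det
  simp only [cross] at h0
  set v := F.a₂ * G.b - F.b₂ * G.a with hv
  have ha : G.a = v * F.a := by
    rw [hv]
    linear_combination (-G.a) * hdet + F.a₂ * h0
  have hb : G.b = v * F.b := by
    rw [hv]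
    linear_combination (-G.b) * hdet + F.b₂ * h0
  have hv0 : v ≠ 0 := by
    intro h
    exact G.coeff_ne_zero (by rw [ha, hb, h, zero_mul, zero_mul])
  have he : F.normal θ = C v⁻¹ * G.normal θ := by
    rw [normal_apply, normal_apply, ha, hb, mul_add, ← mul_assoc, ← mul_assoc, ← map_mul,
      ← map_mul, inv_mul_cancel_left₀ hv0, inv_mul_cancel_left₀ hv0]
  rw [he]
  exact h.mul_left _

end LineFrame

theorem IsAffineLine.exists_frame {L : Set (K × K)} (h : IsAffineLine L) :
    ∃ F : LineFrame K, F.carrier = L := by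
  obtain ⟨a, b, c, h0, rfl⟩ := h
  by_cases hb : b = 0
  · have ha : a ≠ 0 := by
      rintro rfl
      exact h0 (by rw [hb])
    exact ⟨⟨a, b, c, 0, -a⁻¹, by field_simp; ring⟩, rfl⟩
  · exact ⟨⟨a, b, c, b⁻¹, 0, by field_simp; ring⟩, rfl⟩

instance : Nonempty (LineFrame K) := ⟨⟨0, 1, 0, 1, 0, by ring⟩⟩

/-- A choice of frame for each affine line. -/
noncomputable def lineFrame (L : Set (K × K)) : LineFrame K :=
  Function.invFun LineFrame.carrier L

theorem carrier_lineFrame {L : Set (K × K)} (h : IsAffineLine L) : (lineFrame L).carrier = L :=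
  Function.invFun_eq h.exists_frame

theorem carrier_lineFrame_ne {L M : Set (K × K)} (hL : IsAffineLine L) (hM : IsAffineLine M)
    (h : L ≠ M) : (lineFrame L).carrier ≠ (lineFrame M).carrier := by
  rwa [carrier_lineFrame hL, carrier_lineFrame hM]

theorem isRelPrime_form_lineFrame {L M : Set (K × K)} (hL : IsAffineLine L) (hM : IsAffineLine M)
    (h : L ≠ M) : IsRelPrime (lineFrame L).form (lineFrame M).form :=
  LineFrame.isRelPrime_form _ _ (carrier_lineFrame_ne hL hM h)

theorem prod_form_dvd {A : Finset (Set (K × K))} (hA : IsLineArr A) {p : MvPolynomial (Fin 3) K}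
    (h : ∀ L ∈ A, (lineFrame L).form ∣ p) : ∏ L ∈ A, (lineFrame L).form ∣ p :=
  Finset.prod_dvd_of_isRelPrime
    (fun L hL M hM hLM => isRelPrime_form_lineFrame (hA L hL) (hA M hM) hLM) h

/-- The space of homogeneous vector fields `f ∂ₓ + g ∂_y` of degree `d` tangent to the
homogenizations of the lines of `A`. -/
noncomputable def logDer (A : Finset (Set (K × K))) (d : ℕ) :
    Submodule K (MvPolynomial (Fin 3) K × MvPolynomial (Fin 3) K) where
  carrier := {θ | θ.1.IsHomogeneous d ∧ θ.2.IsHomogeneous d ∧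
    ∀ L ∈ A, (lineFrame L).form ∣ (lineFrame L).normal θ}
  add_mem' h₁ h₂ := ⟨h₁.1.add h₂.1, h₁.2.1.add h₂.2.1, fun L hL => by
    rw [map_add]
    exact dvd_add (h₁.2.2 L hL) (h₂.2.2 L hL)⟩
  zero_mem' := ⟨isHomogeneous_zero _ _ _, isHomogeneous_zero _ _ _, fun L _ => by simp⟩
  smul_mem' r θ h := ⟨(homogeneousSubmodule (Fin 3) K d).smul_mem r h.1,
    (homogeneousSubmodule (Fin 3) K d).smul_mem r h.2.1, fun L hL => by
      rw [LinearMap.map_smul_of_tower]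
      exact dvd_smul_of_dvd r (h.2.2 L hL)⟩

theorem mem_logDer {A : Finset (Set (K × K))} {d : ℕ}
    {θ : MvPolynomial (Fin 3) K × MvPolynomial (Fin 3) K} :
    θ ∈ logDer A d ↔ θ.1.IsHomogeneous d ∧ θ.2.IsHomogeneous d ∧
      ∀ L ∈ A, (lineFrame L).form ∣ (lineFrame L).normal θ := Iff.rfl

theorem logDer_anti {A B : Finset (Set (K × K))} (h : A ⊆ B) (d : ℕ) :
    logDer B d ≤ logDer A d :=
  fun _ hθ => ⟨hθ.1, hθ.2.1, fun L hL => hθ.2.2 L (h hL)⟩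

theorem logDer_empty (d : ℕ) : logDer (K := K) ∅ d =
    (homogeneousSubmodule (Fin 3) K d).prod (homogeneousSubmodule (Fin 3) K d) := by
  ext θ
  simp [mem_logDer, Submodule.mem_prod]

/-- A product of submodules is equivalent to the product of the underlying modules. -/
def submoduleProdEquiv {R M N : Type*} [Semiring R] [AddCommMonoid M] [AddCommMonoid N]
    [Module R M] [Module R N] (p : Submodule R M) (q : Submodule R N) : p.prod q ≃ₗ[R] p × q where
  toFun x := (⟨x.1.1, x.2.1⟩, ⟨x.1.2, x.2.2⟩)
  invFun x := ⟨(x.1.1, x.2.1), x.1.2, x.2.2⟩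
  map_add' _ _ := rfl
  map_smul' _ _ := rfl

instance finite_prod_homogeneousSubmodule (d : ℕ) : Module.Finite K
    ((homogeneousSubmodule (Fin 3) K d).prod (homogeneousSubmodule (Fin 3) K d)) :=
  Module.Finite.equiv (submoduleProdEquiv _ _).symm

instance finite_logDer (A : Finset (Set (K × K))) (d : ℕ) : Module.Finite K (logDer A d) := by
  have h := logDer_anti (Finset.empty_subset A) d
  rw [logDer_empty] at h
  exact Submodule.finiteDimensional_of_le h

theorem finrank_logDer_empty (d : ℕ) :
    Module.finrank K (logDer (K := K) ∅ d) = 2 * (d + 2).choose 2 := by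
  rw [logDer_empty, (submoduleProdEquiv _ _).finrank_eq, Module.finrank_prod,
    finrank_homogeneousSubmodule_fin_three, two_mul]

theorem finrank_le_finrank_inf_ker_add {V : Type*} [AddCommGroup V] [Module K V]
    (W : Submodule K V) [Module.Finite K W] (σ : V →ₗ[K] Polynomial K) {b : Polynomial K}
    (hb : b.Monic) {k d : ℕ}
    (h : ∀ v ∈ W, b ∣ σ v ∧ (σ v = 0 ∨ (σ v).natDegree + k ≤ d)) :
    Module.finrank K W ≤
      Module.finrank K (W ⊓ LinearMap.ker σ : Submodule K V) + (d + 1 - k - b.natDegree) := by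
  have h1 := LinearMap.finrank_range_add_finrank_ker (σ.domRestrict W)
  have hker : Module.finrank K (LinearMap.ker (σ.domRestrict W)) =
      Module.finrank K (W ⊓ LinearMap.ker σ : Submodule K V) := by
    have : (LinearMap.ker (σ.domRestrict W)).map W.subtype = W ⊓ LinearMap.ker σ := by
      ext v
      simp [and_comm]
    rw [← this]
    exact (Submodule.finrank_map_subtype_eq _ _).symm
  have hrange : Module.finrank K (LinearMap.range (σ.domRestrict W)) ≤
      d + 1 - k - b.natDegree := by
    have hle : LinearMap.range (σ.domRestrict W) ≤
        (Polynomial.degreeLT K (d + 1 - k - b.natDegree)).map (LinearMap.mulLeft K b) := by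
      rintro _ ⟨v, rfl⟩
      obtain ⟨⟨q, hq⟩, h2⟩ := h v v.2
      refine ⟨q, ?_, hq.symm⟩
      rw [SetLike.mem_coe, Polynomial.mem_degreeLT]
      by_cases hq0 : q = 0
      · simp [hq0]
      · have hσ : σ v ≠ 0 := by
          rw [hq]
          exact mul_ne_zero hb.ne_zero hq0
        have h3 := h2.resolve_left hσ
        rw [hq, hb.natDegree_mul' hq0] at h3
        rw [Polynomial.degree_eq_natDegree hq0]
        exact_mod_cast (by omega : q.natDegree < d + 1 - k - b.natDegree)
    refine (Submodule.finrank_mono hle).trans ((Submodule.finrank_map_le _ _).trans_eq ?_)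
    simp [(Polynomial.degreeLTEquiv K _).finrank_eq]
  omega

open Classical in
/-- The coordinates on `H` of its intersection points with the lines of `A`. -/
noncomputable def meets (A : Finset (Set (K × K))) (H : Set (K × K)) : Finset K :=
  (A.filter fun L => (lineFrame H).cross (lineFrame L) ≠ 0).image
    fun L => (lineFrame H).meet (lineFrame L)

theorem mem_meets {A : Finset (Set (K × K))} {H : Set (K × K)} {t : K} :
    t ∈ meets A H ↔ ∃ L ∈ A, (lineFrame H).cross (lineFrame L) ≠ 0 ∧
      (lineFrame H).meet (lineFrame L) = t := by
  simp [meets, and_assoc]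

section Restriction

variable {A : Finset (Set (K × K))} {H : Set (K × K)}

theorem mem_iff_of_ne {L : Set (K × K)} (hL : IsAffineLine L) (hH : IsAffineLine H) (h : L ≠ H)
    (t : K) : (lineFrame H).point t ∈ L ↔ (lineFrame H).cross (lineFrame L) ≠ 0 ∧
      (lineFrame H).meet (lineFrame L) = t := by
  rw [← LineFrame.point_mem_carrier_iff _ _ (carrier_lineFrame_ne hH hL h.symm),
    carrier_lineFrame hL]

theorem card_meets (hA : IsLineArr A) (hH : IsAffineLine H) (hHA : H ∉ A) :
    (meets A H).card = nOn A H := by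
  have h : {p : K × K | p ∈ H ∧ ∃ L ∈ A, L ≠ H ∧ p ∈ L} =
      (lineFrame H).point '' (meets A H : Set K) := by
    ext p
    constructor
    · rintro ⟨hp, L, hL, hne, hpL⟩
      rw [← carrier_lineFrame hH] at hp
      obtain ⟨t, rfl⟩ := (lineFrame H).exists_point_eq hp
      exact ⟨t, mem_meets.2 ⟨L, hL, (mem_iff_of_ne (hA L hL) hH hne t).1 hpL⟩, rfl⟩
    · rintro ⟨t, ht, rfl⟩
      obtain ⟨L, hL, h⟩ := mem_meets.1 ht
      have hne : L ≠ H := fun h => hHA (h ▸ hL)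
      refine ⟨?_, L, hL, hne, (mem_iff_of_ne (hA L hL) hH hne t).2 h⟩
      have := (lineFrame H).point_mem_carrier t
      rwa [carrier_lineFrame hH] at this
  rw [nOn, h, Set.ncard_image_of_injective _ (lineFrame H).point_injective, Set.ncard_coe_finset]

theorem prod_dvd_tangentRes {d : ℕ} (hHA : H ∉ A)
    {θ : MvPolynomial (Fin 3) K × MvPolynomial (Fin 3) K}
    (hθ : θ ∈ logDer (Finset.cons H A hHA) d) :
    ∏ t ∈ meets A H, (Polynomial.X - Polynomial.C t) ∣ (lineFrame H).tangentRes θ := by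
  refine Finset.prod_dvd_of_coprime
    ((Polynomial.pairwise_coprime_X_sub_C Function.injective_id).set_pairwise _) fun t ht => ?_
  obtain ⟨L, hL, hc, rfl⟩ := mem_meets.1 ht
  have h0 : (lineFrame H).normalRes θ = 0 := by
    obtain ⟨u, hu⟩ := hθ.2.2 H (Finset.mem_cons_self _ _)
    rw [LineFrame.normalRes_apply, hu, map_mul, LineFrame.res_form, zero_mul]
  have h1 := map_dvd (lineFrame H).res (hθ.2.2 L (Finset.mem_cons_of_mem hL))
  rw [LineFrame.res_normal_of_normalRes_eq_zero _ _ h0,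
    LineFrame.res_form_of_cross_ne_zero _ _ hc] at h1
  exact (mul_dvd_mul_iff_left (Polynomial.C_ne_zero.2 hc)).1 h1

theorem exists_eq_form_mul {d : ℕ} (hA : IsLineArr A) (hH : IsAffineLine H) (hHA : H ∉ A)
    {θ : MvPolynomial (Fin 3) K × MvPolynomial (Fin 3) K}
    (hθ : θ ∈ logDer (Finset.cons H A hHA) d) (h : (lineFrame H).tangentRes θ = 0) :
    θ = 0 ∨ ∃ e, d = e + 1 ∧ ∃ η ∈ logDer A e, θ = (lineFrame H).form • η := by
  have h0 : (lineFrame H).normalRes θ = 0 := by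
    obtain ⟨u, hu⟩ := hθ.2.2 H (Finset.mem_cons_self _ _)
    rw [LineFrame.normalRes_apply, hu, map_mul, LineFrame.res_form, zero_mul]
  obtain ⟨h1, h2⟩ := (lineFrame H).res_eq_zero_of_normal_tangent h0 h
  obtain ⟨u, hu⟩ := (lineFrame H).form_dvd_of_res_eq_zero hθ.1 h1
  obtain ⟨v, hv⟩ := (lineFrame H).form_dvd_of_res_eq_zero hθ.2.1 h2
  have hf := (lineFrame H).isHomogeneous_form
  have hu' := hθ.1
  have hv' := hθ.2.1
  rw [hu] at hu'
  rw [hv] at hv'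
  rcases d with _ | e
  · left
    ext1
    · rw [hu, hf.eq_zero_of_mul_of_lt hu' one_pos, Prod.fst_zero]
    · rw [hv, hf.eq_zero_of_mul_of_lt hv' one_pos, Prod.snd_zero]
  · right
    have hθe : θ = (lineFrame H).form • (u, v) := by
      ext1
      · simpa using hu
      · simpa using hv
    refine ⟨e, rfl, (u, v), ⟨hf.of_mul_left (lineFrame H).form_ne_zero hu',
      hf.of_mul_left (lineFrame H).form_ne_zero hv', fun L hL => ?_⟩, hθe⟩
    have h3 := hθ.2.2 L (Finset.mem_cons_of_mem hL)
    rw [hθe, map_smul, smul_eq_mul] at h3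
    exact (isRelPrime_form_lineFrame (hA L hL) hH
      (fun h => hHA (h ▸ hL))).dvd_of_dvd_mul_left h3

theorem form_smul_mem_logDer {d : ℕ} (hHA : H ∉ A)
    {θ : MvPolynomial (Fin 3) K × MvPolynomial (Fin 3) K} (hθ : θ ∈ logDer A d) :
    (lineFrame H).form • θ ∈ logDer (Finset.cons H A hHA) (d + 1) := by
  have hf := (lineFrame H).isHomogeneous_form
  refine ⟨?_, ?_, fun L hL => ?_⟩
  · rw [add_comm]
    exact hf.mul hθ.1
  · rw [add_comm]
    exact hf.mul hθ.2.1
  · rw [map_smul, smul_eq_mul]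
    rcases Finset.mem_cons.1 hL with rfl | hL
    · exact dvd_mul_right _ _
    · exact (hθ.2.2 L hL).mul_left _

theorem finrank_inf_ker_tangentRes_zero (hA : IsLineArr A) (hH : IsAffineLine H) (hHA : H ∉ A) :
    Module.finrank K (logDer (Finset.cons H A hHA) 0 ⊓
      LinearMap.ker (lineFrame H).tangentRes : Submodule K _) = 0 := by
  rw [Submodule.finrank_eq_zero, eq_bot_iff]
  rintro θ ⟨h1, h2⟩
  rcases exists_eq_form_mul hA hH hHA h1 h2 with h | ⟨e, he, -⟩
  · exact h
  · omega

theorem finrank_inf_ker_tangentRes_succ (hA : IsLineArr A) (hH : IsAffineLine H) (hHA : H ∉ A)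
    (d : ℕ) : Module.finrank K (logDer (Finset.cons H A hHA) (d + 1) ⊓
      LinearMap.ker (lineFrame H).tangentRes : Submodule K _) ≤
        Module.finrank K (logDer A d) := by
  have hle : logDer (Finset.cons H A hHA) (d + 1) ⊓ LinearMap.ker (lineFrame H).tangentRes ≤
      (logDer A d).map (LinearMap.lsmul (MvPolynomial (Fin 3) K)
        (MvPolynomial (Fin 3) K × MvPolynomial (Fin 3) K)
          (lineFrame H).form |>.restrictScalars K) := by
    rintro θ ⟨h1, h2⟩
    rcases exists_eq_form_mul hA hH hHA h1 h2 with h | ⟨e, he, η, hη, h⟩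
    · rw [h]
      exact zero_mem _
    · obtain rfl : d = e := by omega
      exact ⟨η, hη, h.symm⟩
  exact (Submodule.finrank_mono hle).trans (Submodule.finrank_map_le _ _)

theorem natDegree_prod_meets (hA : IsLineArr A) (hH : IsAffineLine H) (hHA : H ∉ A) :
    (∏ t ∈ meets A H, (Polynomial.X - Polynomial.C t)).natDegree = nOn A H := by
  rw [Polynomial.natDegree_prod_of_monic _ _ fun t _ => Polynomial.monic_X_sub_C t]
  simp [card_meets hA hH hHA]

theorem finrank_logDer_cons_le_inf_ker (hA : IsLineArr A) (hH : IsAffineLine H) (hHA : H ∉ A)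
    (d : ℕ) : Module.finrank K (logDer (Finset.cons H A hHA) d) ≤
      Module.finrank K (logDer (Finset.cons H A hHA) d ⊓
        LinearMap.ker (lineFrame H).tangentRes : Submodule K _) + (d + 1 - nOn A H) := by
  have h := finrank_le_finrank_inf_ker_add (logDer (Finset.cons H A hHA) d)
    (lineFrame H).tangentRes
    (Polynomial.monic_prod_of_monic (meets A H) _ fun t _ => Polynomial.monic_X_sub_C t)
    (k := 0) (d := d) fun θ hθ => ⟨prod_dvd_tangentRes hHA hθ,
      Or.inr ((lineFrame H).natDegree_res_le ((lineFrame H).isHomogeneous_tangent hθ.1 hθ.2.1))⟩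
  rwa [natDegree_prod_meets hA hH hHA, Nat.sub_zero] at h

theorem finrank_logDer_cons_succ_le (hA : IsLineArr A) (hH : IsAffineLine H) (hHA : H ∉ A)
    (d : ℕ) : Module.finrank K (logDer (Finset.cons H A hHA) (d + 1)) ≤
      Module.finrank K (logDer A d) + (d + 2 - nOn A H) :=
  (finrank_logDer_cons_le_inf_ker hA hH hHA (d + 1)).trans
    (Nat.add_le_add_right (finrank_inf_ker_tangentRes_succ hA hH hHA d) _)

open Classical in
/-- The product of the linear factors forced upon the normal component along `H` of a field
tangent to the lines of `A`. -/
noncomputable def normalFactor (A : Finset (Set (K × K))) (H : Set (K × K)) : Polynomial K :=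
  ∏ t ∈ meets A H, (Polynomial.X - Polynomial.C t) ^
    ((A.filter fun L => (lineFrame H).cross (lineFrame L) ≠ 0 ∧
      (lineFrame H).meet (lineFrame L) = t).card - 1)

theorem monic_normalFactor (A : Finset (Set (K × K))) (H : Set (K × K)) :
    (normalFactor A H).Monic :=
  Polynomial.monic_prod_of_monic _ _ fun t _ => (Polynomial.monic_X_sub_C t).pow _

open Classical in
theorem natDegree_normalFactor (hA : IsLineArr A) (hH : IsAffineLine H) (hHA : H ∉ A) :
    (normalFactor A H).natDegree + nOn A H =
      (A.filter fun L => (lineFrame H).cross (lineFrame L) ≠ 0).card := by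
  rw [normalFactor, Polynomial.natDegree_prod_of_monic _ _ fun t _ =>
    (Polynomial.monic_X_sub_C t).pow _, ← card_meets hA hH hHA, Finset.card_eq_sum_ones,
    ← Finset.sum_add_distrib, meets, Finset.card_eq_sum_card_image
      (fun L => (lineFrame H).meet (lineFrame L))
      (A.filter fun L => (lineFrame H).cross (lineFrame L) ≠ 0)]
  refine Finset.sum_congr rfl fun t ht => ?_
  rw [Polynomial.natDegree_pow, Polynomial.natDegree_X_sub_C, mul_one, Finset.filter_filter]
  refine Nat.sub_add_cancel (Finset.card_pos.2 ?_)
  obtain ⟨L, hL, h⟩ := mem_meets.1 ht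
  exact ⟨L, Finset.mem_filter.2 ⟨hL, h⟩⟩

theorem normalFactor_dvd_normalRes {d : ℕ} (hA : IsLineArr A) (hH : IsAffineLine H) (hHA : H ∉ A)
    {θ : MvPolynomial (Fin 3) K × MvPolynomial (Fin 3) K} (hθ : θ ∈ logDer A d) :
    normalFactor A H ∣ (lineFrame H).normalRes θ := by
  classical
  refine Finset.prod_dvd_of_coprime (fun s _ t _ hst =>
    (Polynomial.pairwise_coprime_X_sub_C Function.injective_id hst).pow) fun t ht => ?_
  set M := A.filter fun L => (lineFrame H).cross (lineFrame L) ≠ 0 ∧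
      (lineFrame H).meet (lineFrame L) = t with hM
  have hpos : 0 < M.card := by
    obtain ⟨L, hL, h⟩ := mem_meets.1 ht
    exact Finset.card_pos.2 ⟨L, Finset.mem_filter.2 ⟨hL, h⟩⟩
  have hMA : ∀ L ∈ M, L ∈ A := fun L hL => (Finset.mem_filter.1 hL).1
  have h1 := map_dvd (lineFrame H).res (prod_form_dvd (fun L hL => hA L (hMA L hL))
    (p := (X 0 - C ((lineFrame H).point t).1 * X 2) * θ.2 -
      (X 1 - C ((lineFrame H).point t).2 * X 2) * θ.1) fun L hL => by
        refine LineFrame.form_dvd_wedge _ ?_ (hθ.2.2 L (hMA L hL))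
        rw [carrier_lineFrame (hA L (hMA L hL)), mem_iff_of_ne (hA L (hMA L hL)) hH
          (fun h => hHA (h ▸ hMA L hL))]
        exact (Finset.mem_filter.1 hL).2)
  rw [LineFrame.res_wedge, map_prod] at h1
  have h2 : ∏ L ∈ M, (lineFrame H).res (lineFrame L).form =
      Polynomial.C (∏ L ∈ M, (lineFrame H).cross (lineFrame L)) *
        (Polynomial.X - Polynomial.C t) ^ M.card := by
    rw [map_prod, ← Finset.prod_const, ← Finset.prod_mul_distrib]
    refine Finset.prod_congr rfl fun L hL => ?_
    obtain ⟨-, h3, h4⟩ := Finset.mem_filter.1 hL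
    rw [LineFrame.res_form_of_cross_ne_zero _ _ h3, h4]
  have h3 : (Polynomial.X - Polynomial.C t) ^ M.card ∣
      (Polynomial.X - Polynomial.C t) * (lineFrame H).normalRes θ :=
    (Dvd.intro_left _ h2.symm).trans h1
  obtain ⟨m, hm⟩ := Nat.exists_eq_succ_of_ne_zero hpos.ne'
  rw [hm, Nat.succ_eq_add_one, pow_succ', mul_dvd_mul_iff_left (Polynomial.X_sub_C_ne_zero t)] at h3
  rwa [hm, Nat.succ_eq_add_one, Nat.add_sub_cancel]

open Classical in
theorem normalRes_eq_zero_or {d : ℕ} (hA : IsLineArr A) (hH : IsAffineLine H) (hHA : H ∉ A)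
    {θ : MvPolynomial (Fin 3) K × MvPolynomial (Fin 3) K} (hθ : θ ∈ logDer A d) :
    (lineFrame H).normalRes θ = 0 ∨ ((lineFrame H).normalRes θ).natDegree +
      (A.filter fun L => (lineFrame H).cross (lineFrame L) = 0).card ≤ d := by
  set M := A.filter fun L => (lineFrame H).cross (lineFrame L) = 0 with hM
  have hMA : ∀ L ∈ M, L ∈ A := fun L hL => (Finset.mem_filter.1 hL).1
  obtain ⟨u, hu⟩ := prod_form_dvd (fun L hL => hA L (hMA L hL)) (p := (lineFrame H).normal θ)
    fun L hL => LineFrame.form_dvd_normal_of_cross_eq_zero _ _ (Finset.mem_filter.1 hL).2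
      (hθ.2.2 L (hMA L hL))
  have hhom := (lineFrame H).isHomogeneous_normal hθ.1 hθ.2.1
  have hprod : (∏ L ∈ M, (lineFrame L).form).IsHomogeneous M.card := by
    have := IsHomogeneous.prod M (fun L => (lineFrame L).form) (fun _ => 1)
      fun L _ => (lineFrame L).isHomogeneous_form
    rwa [← Finset.card_eq_sum_ones] at this
  rw [hu] at hhom
  rcases lt_or_ge d M.card with hd | hd
  · left
    rw [LineFrame.normalRes_apply, hu, hprod.eq_zero_of_mul_of_lt hhom hd, map_zero]
  · right
    obtain ⟨e, rfl⟩ := Nat.exists_eq_add_of_le' hd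
    have hu' := hprod.of_mul_left
      (Finset.prod_ne_zero_iff.2 fun L _ => (lineFrame L).form_ne_zero) hhom
    rw [LineFrame.normalRes_apply, hu, map_mul, map_prod]
    refine Nat.add_le_add_right (Polynomial.natDegree_mul_le.trans ?_) _
    have h0 : (∏ L ∈ M, (lineFrame H).res (lineFrame L).form).natDegree ≤ 0 := by
      refine (Polynomial.natDegree_prod_le _ _).trans_eq (Finset.sum_eq_zero fun L hL => ?_)
      obtain ⟨v, -, hv⟩ := LineFrame.exists_res_form_eq_C (lineFrame H) (lineFrame L)
        (carrier_lineFrame_ne hH (hA L (hMA L hL)) fun h => hHA (h ▸ hMA L hL))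
        (Finset.mem_filter.1 hL).2
      rw [hv, Polynomial.natDegree_C]
    have h1 := (lineFrame H).natDegree_res_le hu'
    omega

theorem mem_logDer_cons_of_normalRes_eq_zero {d : ℕ} (hHA : H ∉ A)
    {θ : MvPolynomial (Fin 3) K × MvPolynomial (Fin 3) K} (hθ : θ ∈ logDer A d)
    (h : (lineFrame H).normalRes θ = 0) : θ ∈ logDer (Finset.cons H A hHA) d := by
  refine ⟨hθ.1, hθ.2.1, fun L hL => ?_⟩
  rcases Finset.mem_cons.1 hL with rfl | hL
  · exact LineFrame.form_dvd_of_res_eq_zero _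
      ((lineFrame L).isHomogeneous_normal hθ.1 hθ.2.1) h
  · exact hθ.2.2 L hL

open Classical in
theorem card_parallel_add (A : Finset (Set (K × K))) (H : Set (K × K)) :
    (A.filter fun L => (lineFrame H).cross (lineFrame L) = 0).card +
      (A.filter fun L => (lineFrame H).cross (lineFrame L) ≠ 0).card = A.card :=
  Finset.card_filter_add_card_filter_not _

theorem nOn_le_card (hA : IsLineArr A) (hH : IsAffineLine H) (hHA : H ∉ A) :
    nOn A H ≤ A.card := by
  classical
  have h1 := natDegree_normalFactor hA hH hHA
  have h2 := card_parallel_add A H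
  omega

theorem finrank_logDer_le_inf_ker (hA : IsLineArr A) (hH : IsAffineLine H) (hHA : H ∉ A)
    (d : ℕ) : Module.finrank K (logDer A d) ≤
      Module.finrank K (logDer A d ⊓ LinearMap.ker (lineFrame H).normalRes : Submodule K _) +
        (d + 1 - (A.card - nOn A H)) := by
  classical
  have h := finrank_le_finrank_inf_ker_add (logDer A d) (lineFrame H).normalRes
    (monic_normalFactor A H) fun θ hθ => ⟨normalFactor_dvd_normalRes hA hH hHA hθ,
      normalRes_eq_zero_or hA hH hHA hθ⟩
  have h1 := natDegree_normalFactor hA hH hHA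
  have h2 := card_parallel_add A H
  omega

theorem finrank_logDer_le (hA : IsLineArr A) (hH : IsAffineLine H) (hHA : H ∉ A)
    (d : ℕ) : Module.finrank K (logDer A d) ≤
      Module.finrank K (logDer (Finset.cons H A hHA) d) + (d + 1 - (A.card - nOn A H)) :=
  (finrank_logDer_le_inf_ker hA hH hHA d).trans (Nat.add_le_add_right
    (Submodule.finrank_mono fun θ (hθ : θ ∈ logDer A d ∧ (lineFrame H).normalRes θ = 0) =>
      mem_logDer_cons_of_normalRes_eq_zero hHA hθ.1 hθ.2) _)

end Restriction

theorem sum_powerset_nonempty_neg_one_pow {α : Type*} [DecidableEq α] {A M : Finset α}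
    (hMA : M ⊆ A) (hM : M.Nonempty) :
    ∑ B ∈ A.powerset, (if B.Nonempty ∧ B ⊆ M then (-1 : ℤ) ^ (B.card + 1) else 0) = 1 := by
  rw [← Finset.sum_filter]
  have h : A.powerset.filter (fun B => B.Nonempty ∧ B ⊆ M) = M.powerset.erase ∅ := by
    ext B
    simp only [Finset.mem_filter, Finset.mem_powerset, Finset.mem_erase, ne_eq,
      Finset.nonempty_iff_ne_empty]
    exact ⟨fun h => h.2, fun h => ⟨h.2.trans hMA, h⟩⟩
  rw [h, Finset.sum_erase_eq_sub (Finset.empty_mem_powerset M)]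
  simp_rw [pow_succ]
  rw [← Finset.sum_mul, Finset.sum_powerset_neg_one_pow_card_of_nonempty hM]
  simp

theorem b2_cons {A : Finset (Set (K × K))} {H : Set (K × K)} (hA : IsLineArr A)
    (hH : IsAffineLine H) (hHA : H ∉ A) :
    b2 (Finset.cons H A hHA) = b2 A + nOn A H := by
  classical
  have key : ∀ B ∈ A.powerset,
      (if 2 ≤ (insert H B).card ∧ (⋂ L ∈ insert H B, (L : Set (K × K))).Nonempty then
        (-1 : ℤ) ^ (insert H B).card else 0) =
      ∑ t ∈ meets A H, if B.Nonempty ∧ B ⊆ A.filter (fun L =>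
        (lineFrame H).cross (lineFrame L) ≠ 0 ∧ (lineFrame H).meet (lineFrame L) = t) then
          (-1 : ℤ) ^ (B.card + 1) else 0 := by
    intro B hB
    rw [Finset.mem_powerset] at hB
    have hne : ∀ L ∈ B, L ≠ H := fun L hL h => hHA (h ▸ hB hL)
    have hHB : H ∉ B := fun h => hHA (hB h)
    have hsub : ∀ t, B ⊆ A.filter (fun L =>
        (lineFrame H).cross (lineFrame L) ≠ 0 ∧ (lineFrame H).meet (lineFrame L) = t) ↔
        ∀ L ∈ B, (lineFrame H).point t ∈ L := by
      intro t
      refine ⟨fun h L hL => ?_, fun h L hL => Finset.mem_filter.2 ⟨hB hL, ?_⟩⟩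
      · exact (mem_iff_of_ne (hA L (hB hL)) hH (hne L hL) t).2 (Finset.mem_filter.1 (h hL)).2
      · exact (mem_iff_of_ne (hA L (hB hL)) hH (hne L hL) t).1 (h L hL)
    simp_rw [hsub]
    rw [Finset.card_insert_of_notMem hHB]
    rcases B.eq_empty_or_nonempty with rfl | hBn
    · simp
    have hcard : 2 ≤ B.card + 1 := by
      have := Finset.card_pos.2 hBn
      omega
    simp only [hcard, hBn, true_and]
    split_ifs with hI
    · obtain ⟨p, hp⟩ := hI
      simp only [Set.mem_iInter, Finset.mem_insert, forall_eq_or_imp] at hp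
      obtain ⟨t, rfl⟩ := (lineFrame H).exists_point_eq ((carrier_lineFrame hH).symm ▸ hp.1)
      obtain ⟨L, hL⟩ := hBn
      have ht := (mem_iff_of_ne (hA L (hB hL)) hH (hne L hL) t).1 (hp.2 L hL)
      rw [Finset.sum_eq_single t, if_pos hp.2]
      · intro s _ hst
        refine if_neg fun h => hst ?_
        rw [← ht.2, ← ((mem_iff_of_ne (hA L (hB hL)) hH (hne L hL) s).1 (h L hL)).2]
      · exact fun h => absurd (mem_meets.2 ⟨L, hB hL, ht⟩) h
    · refine (Finset.sum_eq_zero fun t _ => if_neg fun h => hI ⟨(lineFrame H).point t, ?_⟩).symm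
      simp only [Set.mem_iInter, Finset.mem_insert, forall_eq_or_imp]
      refine ⟨?_, h⟩
      have := (lineFrame H).point_mem_carrier t
      rwa [carrier_lineFrame hH] at this
  rw [b2, b2, Finset.sum_filter, Finset.sum_filter, Finset.cons_eq_insert,
    Finset.sum_powerset_insert hHA]
  congr 1
  rw [Finset.sum_congr rfl key, Finset.sum_comm, ← card_meets hA hH hHA, Finset.card_eq_sum_ones,
    Nat.cast_sum]
  refine Finset.sum_congr rfl fun t ht => ?_
  rw [Nat.cast_one]
  refine sum_powerset_nonempty_neg_one_pow (Finset.filter_subset _ _) ?_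
  obtain ⟨L, hL, h⟩ := mem_meets.1 ht
  exact ⟨L, Finset.mem_filter.2 ⟨hL, h⟩⟩

theorem b2_empty : b2 (∅ : Finset (Set (K × K))) = 0 := by
  classical
  rw [b2, Finset.powerset_empty, Finset.sum_filter]
  simp

theorem finrank_logDer_of_card_le {A : Finset (Set (K × K))} (hA : IsLineArr A) {d : ℕ}
    (hd : A.card ≤ d) : 2 * (Module.finrank K (logDer A d) : ℤ) =
      2 * (d + 2) * (d + 1) - A.card * (2 * d + 3) + (A.card : ℤ) ^ 2 - 2 * b2 A := by
  induction A using Finset.cons_induction generalizing d with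
  | empty =>
    have h : (d + 2).choose 2 * 2 = (d + 2) * (d + 1) := by
      rw [Nat.choose_two_right, Nat.div_mul_cancel (Nat.even_mul_pred_self (d + 2)).two_dvd]
      rfl
    rw [finrank_logDer_empty, b2_empty, Finset.card_empty]
    zify at h
    push_cast
    linear_combination 2 * h
  | cons H A hHA ih =>
    have hA' : IsLineArr A := fun L hL => hA L (Finset.mem_cons_of_mem hL)
    have hH := hA H (Finset.mem_cons_self _ _)
    rw [Finset.card_cons] at hd ⊢
    obtain ⟨m, rfl⟩ := Nat.exists_eq_add_of_le' (le_of_add_le_right hd)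
    have h1 := finrank_logDer_cons_succ_le hA' hH hHA m
    have h2 := finrank_logDer_le hA' hH hHA (m + 1)
    have h3 := nOn_le_card hA' hH hHA
    have h4 := ih hA' (d := m) (by omega)
    have h5 := ih hA' (d := m + 1) (by omega)
    rw [b2_cons hA' hH hHA]
    have h6 : ((m + 2 - nOn A H : ℕ) : ℤ) = m + 2 - nOn A H := by
      rw [Nat.cast_sub (by omega)]
      push_cast
      ring
    have h7 : ((m + 1 + 1 - (A.card - nOn A H) : ℕ) : ℤ) = m + 2 - (A.card - nOn A H) := by
      rw [Nat.cast_sub (by omega), Nat.cast_sub h3]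
      push_cast
      ring
    zify at h1 h2
    rw [h6] at h1
    rw [h7] at h2
    push_cast at h5 ⊢
    apply le_antisymm
    · linarith
    · linarith

theorem two_mul_sum_range_sub (e n : ℕ) :
    2 * ∑ i ∈ Finset.range n, (i + 1 - e) = (n - e) * (n + 1 - e) := by
  induction n with
  | zero => simp
  | succ n ih =>
    rw [Finset.sum_range_succ, mul_add, ih]
    rcases le_or_gt e n with h | h
    · obtain ⟨k, rfl⟩ := Nat.exists_eq_add_of_le h
      rw [show e + k - e = k by omega, show e + k + 1 - e = k + 1 by omega,
        show e + k + 1 + 1 - e = k + 2 by omega]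
      ring
    · rw [show n - e = 0 by omega, show n + 1 - e = 0 by omega]
      simp

theorem eq_of_growth_bounds {u v : ℕ → ℕ} {e f : ℕ} (hf : 0 < f) (hu0 : u 0 ≤ 1 - e)
    (hu : ∀ d, u (d + 1) ≤ v d + (d + 2 - e)) (hv : ∀ d, v d ≤ u d + (d + 2 - f)) {D : ℕ}
    (hD : ∀ d, D ≤ d → 2 * (u d : ℤ) =
      2 * (d + 2) * (d + 1) - (e + f) * (2 * d + 3) + (e : ℤ) ^ 2 + (f : ℤ) ^ 2) :
    u 0 = 1 - e ∧ (∀ d, u (d + 1) = v d + (d + 2 - e)) ∧ ∀ d, v d = u d + (d + 2 - f) := by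
  set F : ℕ → ℕ := fun d => ∑ i ∈ Finset.range (d + 1), (i + 1 - e) +
    ∑ i ∈ Finset.range (d + 1), (i + 1 - f) with hF
  have hF0 : F 0 = 1 - e := by
    simp only [hF, zero_add, Finset.sum_range_one]
    omega
  have hFs : ∀ d, F (d + 1) = F d + (d + 2 - e) + (d + 2 - f) := by
    intro d
    simp only [hF]
    rw [Finset.sum_range_succ _ (d + 1), Finset.sum_range_succ _ (d + 1)]
    ring
  have hle : ∀ d, u d ≤ F d := by
    intro d
    induction d with
    | zero => rwa [hF0]
    | succ d ih =>
      have := hu d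
      have := hv d
      have := hFs d
      omega
  have hback : ∀ d k, u (d + k) = F (d + k) → u d = F d := by
    intro d k
    induction k with
    | zero => exact id
    | succ k ih =>
      intro h
      apply ih
      have := hu (d + k)
      have := hv (d + k)
      have := hFs (d + k)
      have := hle (d + k)
      rw [← add_assoc] at h
      omega
  have heq : ∀ d, u d = F d := by
    intro d
    refine hback d (D + e + f) ?_
    have h1 := two_mul_sum_range_sub e (d + (D + e + f) + 1)
    have h2 := two_mul_sum_range_sub f (d + (D + e + f) + 1)
    have h3 := hD (d + (D + e + f)) (by omega)
    rw [show d + (D + e + f) + 1 - e = d + D + f + 1 by omega,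
      show d + (D + e + f) + 1 + 1 - e = d + D + f + 2 by omega] at h1
    rw [show d + (D + e + f) + 1 - f = d + D + e + 1 by omega,
      show d + (D + e + f) + 1 + 1 - f = d + D + e + 2 by omega] at h2
    simp only [hF]
    zify at h1 h2 ⊢
    push_cast at h3
    linarith
  refine ⟨(heq 0).trans hF0, fun d => ?_, fun d => ?_⟩
  all_goals
    have := hu d
    have := hv d
    have := hFs d
    have := heq d
    have := heq (d + 1)
    omega

theorem smul_mem_logDer {A : Finset (Set (K × K))} {i j : ℕ} {p : MvPolynomial (Fin 3) K}
    (hp : p.IsHomogeneous i) {θ : MvPolynomial (Fin 3) K × MvPolynomial (Fin 3) K}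
    (hθ : θ ∈ logDer A j) : p • θ ∈ logDer A (i + j) :=
  ⟨hp.mul hθ.1, hp.mul hθ.2.1, fun L hL => by
    rw [map_smul]
    exact (hθ.2.2 L hL).mul_left p⟩

theorem LineFrame.exists_res_mul_eq (F : LineFrame K) {b r s : Polynomial K} {k d m : ℕ}
    (hm : b.natDegree + k = m) (hb : b.Monic) (hr : b ∣ r) (hr0 : r ≠ 0)
    (hrm : r = 0 ∨ r.natDegree + k ≤ m) (hs : b ∣ s) (hsd : s = 0 ∨ s.natDegree + k ≤ d) :
    ∃ p : MvPolynomial (Fin 3) K, F.res p * r = s ∧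
      (p = 0 ∨ ∃ i, i + m = d ∧ p.IsHomogeneous i) := by
  by_cases hs0 : s = 0
  · exact ⟨0, by simp [hs0], Or.inl rfl⟩
  obtain ⟨w, rfl⟩ := hr
  obtain ⟨q, rfl⟩ := hs
  have hw0 := right_ne_zero_of_mul hr0
  have hq0 := right_ne_zero_of_mul hs0
  replace hrm := hrm.resolve_left hr0
  replace hsd := hsd.resolve_left hs0
  rw [hb.natDegree_mul' hw0] at hrm
  rw [hb.natDegree_mul' hq0] at hsd
  have hw : w.natDegree = 0 := by omega
  rw [Polynomial.natDegree_eq_zero] at hw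
  obtain ⟨c, rfl⟩ := hw
  have hc : c ≠ 0 := Polynomial.C_ne_zero.1 hw0
  obtain ⟨i, hi⟩ := Nat.exists_eq_add_of_le' (show m ≤ d by omega)
  obtain ⟨p, hp, hpq⟩ := F.exists_res_eq (q := Polynomial.C c⁻¹ * q) (d := i)
    ((Polynomial.natDegree_C_mul_le _ _).trans (by omega))
  refine ⟨p, ?_, Or.inr ⟨i, hi.symm, hp⟩⟩
  rw [hpq]
  have : Polynomial.C c⁻¹ * Polynomial.C c = 1 := by
    rw [← Polynomial.C_mul, inv_mul_cancel₀ hc, Polynomial.C_1]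
  linear_combination b * q * this

section Basis

variable {A : Finset (Set (K × K))} {H : Set (K × K)}

/-- If `θ₁` and `θ₂` have nonzero restrictions of the smallest possible degrees, then they
generate all tangent fields. -/
theorem exists_eq_smul_add_smul (hA : IsLineArr A) (hH : IsAffineLine H) (hHA : H ∉ A)
    {θ₁ θ₂ : MvPolynomial (Fin 3) K × MvPolynomial (Fin 3) K}
    (h₁ : θ₁ ∈ logDer (Finset.cons H A hHA) (nOn A H))
    (h₂ : θ₂ ∈ logDer A (A.card - nOn A H))
    (h₁' : (lineFrame H).tangentRes θ₁ ≠ 0) (h₂' : (lineFrame H).normalRes θ₂ ≠ 0) {d : ℕ}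
    {θ : MvPolynomial (Fin 3) K × MvPolynomial (Fin 3) K}
    (hθ : θ ∈ logDer (Finset.cons H A hHA) d) :
    ∃ p₁ p₂ : MvPolynomial (Fin 3) K, θ = p₁ • θ₁ + p₂ • ((lineFrame H).form • θ₂) := by
  classical
  have hsub : ∀ d, logDer (Finset.cons H A hHA) d ≤ logDer A d :=
    logDer_anti (Finset.subset_cons hHA)
  have hdeg : ∀ {j : ℕ} {η : MvPolynomial (Fin 3) K × MvPolynomial (Fin 3) K},
      η ∈ logDer (Finset.cons H A hHA) j →
      ((lineFrame H).tangentRes η).natDegree + 0 ≤ j := fun hη =>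
    (lineFrame H).natDegree_res_le ((lineFrame H).isHomogeneous_tangent hη.1 hη.2.1)
  induction d using Nat.strong_induction_on generalizing θ with
  | _ d ih =>
    obtain ⟨p, hp, hp'⟩ := (lineFrame H).exists_res_mul_eq (k := 0)
      (by rw [add_zero, natDegree_prod_meets hA hH hHA])
      (Polynomial.monic_prod_of_monic (meets A H) _ fun t _ => Polynomial.monic_X_sub_C t)
      (prod_dvd_tangentRes hHA h₁) h₁' (Or.inr (hdeg h₁)) (prod_dvd_tangentRes hHA hθ)
      (Or.inr (hdeg hθ))
    have hmem : θ - p • θ₁ ∈ logDer (Finset.cons H A hHA) d := by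
      refine sub_mem hθ ?_
      rcases hp' with rfl | ⟨i, rfl, hi⟩
      · rw [zero_smul]
        exact zero_mem _
      · exact smul_mem_logDer hi h₁
    have hres : (lineFrame H).tangentRes (θ - p • θ₁) = 0 := by
      rw [map_sub, LineFrame.tangentRes_apply _ (p • θ₁), map_smul, smul_eq_mul, map_mul,
        ← LineFrame.tangentRes_apply, hp, sub_self]
    rcases exists_eq_form_mul hA hH hHA hmem hres with h0 | ⟨e, rfl, η, hη, h0⟩
    · exact ⟨p, 0, by rw [zero_smul, add_zero, ← sub_eq_zero, h0]⟩
    obtain ⟨q, hq, hq'⟩ := (lineFrame H).exists_res_mul_eq (m := A.card - nOn A H)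
      (by
        have h3 := natDegree_normalFactor hA hH hHA
        have h4 := card_parallel_add A H
        omega) (monic_normalFactor A H)
      (normalFactor_dvd_normalRes hA hH hHA h₂) h₂' (normalRes_eq_zero_or hA hH hHA h₂)
      (normalFactor_dvd_normalRes hA hH hHA hη) (normalRes_eq_zero_or hA hH hHA hη)
    have hmem' : η - q • θ₂ ∈ logDer A e := by
      refine sub_mem hη ?_
      rcases hq' with rfl | ⟨i, rfl, hi⟩
      · rw [zero_smul]
        exact zero_mem _
      · exact smul_mem_logDer hi h₂
    have hres' : (lineFrame H).normalRes (η - q • θ₂) = 0 := by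
      rw [map_sub, LineFrame.normalRes_apply _ (q • θ₂), map_smul, smul_eq_mul, map_mul,
        ← LineFrame.normalRes_apply, hq, sub_self]
    obtain ⟨p₁, p₂, h5⟩ := ih e (Nat.lt_succ_self e)
      (mem_logDer_cons_of_normalRes_eq_zero hHA hmem' hres')
    refine ⟨p + (lineFrame H).form * p₁, q + (lineFrame H).form * p₂, ?_⟩
    rw [sub_eq_iff_eq_add] at h0 h5
    rw [h0, h5]
    ext1 <;> simp only [Prod.fst_add, Prod.snd_add, Prod.smul_fst, Prod.smul_snd, smul_eq_mul] <;>
      ring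

theorem det_ne_zero_of_res_ne_zero (hHA : H ∉ A) {d : ℕ}
    {θ₁ θ₂ : MvPolynomial (Fin 3) K × MvPolynomial (Fin 3) K}
    (h₁ : θ₁ ∈ logDer (Finset.cons H A hHA) d)
    (h₁' : (lineFrame H).tangentRes θ₁ ≠ 0) (h₂' : (lineFrame H).normalRes θ₂ ≠ 0) :
    θ₁.1 * ((lineFrame H).form • θ₂).2 - θ₁.2 * ((lineFrame H).form • θ₂).1 ≠ 0 := by
  have h0 : (lineFrame H).normalRes θ₁ = 0 := by
    obtain ⟨u, hu⟩ := h₁.2.2 H (Finset.mem_cons_self _ _)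
    rw [LineFrame.normalRes_apply, hu, map_mul, LineFrame.res_form, zero_mul]
  have hdet := congrArg Polynomial.C (lineFrame H).det
  have key : (lineFrame H).res (θ₁.1 * θ₂.2 - θ₁.2 * θ₂.1) =
      (lineFrame H).tangentRes θ₁ * (lineFrame H).normalRes θ₂ := by
    simp only [LineFrame.normalRes_apply, LineFrame.tangentRes_apply, LineFrame.normal_apply,
      LineFrame.tangent_apply, map_add, map_mul, LineFrame.res_C, map_sub, map_one] at h0 hdet ⊢
    set F := lineFrame H
    linear_combination (-(F.res θ₁.1 * F.res θ₂.2 - F.res θ₁.2 * F.res θ₂.1)) * hdet -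
      (Polynomial.C F.b₂ * F.res θ₂.2 + Polynomial.C F.a₂ * F.res θ₂.1) * h0
  have h1 : θ₁.1 * θ₂.2 - θ₁.2 * θ₂.1 ≠ 0 := by
    intro h
    rw [h, map_zero] at key
    exact mul_ne_zero h₁' h₂' key.symm
  rw [show θ₁.1 * ((lineFrame H).form • θ₂).2 - θ₁.2 * ((lineFrame H).form • θ₂).1 =
    (lineFrame H).form * (θ₁.1 * θ₂.2 - θ₁.2 * θ₂.1) by
      simp only [Prod.smul_fst, Prod.smul_snd, smul_eq_mul]
      ring]
  exact mul_ne_zero (lineFrame H).form_ne_zero h1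

theorem exists_tangentRes_ne_zero_and_normalRes_ne_zero (hA : IsLineArr A) (hH : IsAffineLine H)
    (hHA : H ∉ A) (hb : b2 (Finset.cons H A hHA) = nOn A H * (A.card + 1 - nOn A H)) :
    (∃ θ ∈ logDer (Finset.cons H A hHA) (nOn A H), (lineFrame H).tangentRes θ ≠ 0) ∧
      ∃ θ ∈ logDer A (A.card - nOn A H), (lineFrame H).normalRes θ ≠ 0 := by
  have hle := nOn_le_card hA hH hHA
  have hcons : IsLineArr (Finset.cons H A hHA) := by
    intro L hL
    rcases Finset.mem_cons.1 hL with rfl | hL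
    · exact hH
    · exact hA L hL
  obtain ⟨g1, g2, g3⟩ := eq_of_growth_bounds
    (u := fun d => Module.finrank K (logDer (Finset.cons H A hHA) d))
    (v := fun d => Module.finrank K (logDer A d)) (e := nOn A H) (f := A.card - nOn A H + 1)
    (Nat.succ_pos _)
    (by
      have := finrank_logDer_cons_le_inf_ker hA hH hHA 0
      rwa [finrank_inf_ker_tangentRes_zero hA hH hHA, zero_add, zero_add] at this)
    (finrank_logDer_cons_succ_le hA hH hHA)
    (fun d => by
      have := finrank_logDer_le hA hH hHA d
      rwa [show d + 2 - (A.card - nOn A H + 1) = d + 1 - (A.card - nOn A H) by omega])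
    (D := A.card + 1) (fun d hd => by
      rw [finrank_logDer_of_card_le hcons (by rwa [Finset.card_cons]), hb, Finset.card_cons]
      push_cast [Nat.cast_sub hle]
      ring)
  constructor
  · by_contra! h
    have hinf : logDer (Finset.cons H A hHA) (nOn A H) ⊓
        LinearMap.ker (lineFrame H).tangentRes = logDer (Finset.cons H A hHA) (nOn A H) :=
      inf_eq_left.2 fun θ hθ => h θ hθ
    rcases Nat.eq_zero_or_eq_succ_pred (nOn A H) with he | he
    · rw [he] at hinf g1
      have := finrank_inf_ker_tangentRes_zero hA hH hHA
      rw [hinf] at this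
      omega
    · have h1 := g2 (nOn A H).pred
      have h2 := finrank_inf_ker_tangentRes_succ hA hH hHA (nOn A H).pred
      rw [← Nat.succ_eq_add_one, ← he] at h1 h2
      rw [hinf] at h2
      omega
  · by_contra! h
    have hle' : logDer A (A.card - nOn A H) ≤
        logDer (Finset.cons H A hHA) (A.card - nOn A H) := fun θ hθ =>
      mem_logDer_cons_of_normalRes_eq_zero hHA hθ (h θ hθ)
    have h1 := g3 (A.card - nOn A H)
    have h2 := Submodule.finrank_mono hle'
    omega

end Basis

theorem applyDer3_lin3 (θ : Fin 3 → MvPolynomial (Fin 3) K) (a b c : K) :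
    applyDer3 θ (lin3 a b c) = C a * θ 0 + C b * θ 1 + C c * θ 2 := by
  simp [applyDer3, lin3, Fin.sum_univ_three, pderiv_X, Pi.single_apply]
  ring

theorem applyDer3_X_two (θ : Fin 3 → MvPolynomial (Fin 3) K) :
    applyDer3 θ (X 2) = θ 2 := by
  simp [applyDer3, pderiv_X, Pi.single_apply]

theorem inDCone_of_dvd {A : Finset (Set (K × K))} (hA : IsLineArr A)
    {η : MvPolynomial (Fin 3) K × MvPolynomial (Fin 3) K}
    (h : ∀ L ∈ A, (lineFrame L).form ∣ (lineFrame L).normal η) :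
    InDCone A ![η.1, η.2, 0] := by
  refine ⟨fun L hL a b c _ hLe => ?_, 0, by simp [applyDer3_X_two]⟩
  obtain ⟨g, hg⟩ := h L hL
  have hsub : ∀ p : K × K, (lineFrame L).a * p.1 + (lineFrame L).b * p.2 + (lineFrame L).c = 0 →
      a * p.1 + b * p.2 + c = 0 := by
    intro p hp
    have h1 : p ∈ (lineFrame L).carrier := hp
    rw [carrier_lineFrame (hA L hL), hLe] at h1
    exact h1
  obtain ⟨u, rfl, rfl, rfl⟩ := exists_smul_of_forall_line (lineFrame L).coeff_ne_zero hsub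
  refine ⟨g, ?_⟩
  rw [LineFrame.normal_apply, LineFrame.form, lin3] at hg
  rw [applyDer3_lin3, lin3]
  simp only [map_mul, Matrix.cons_val_zero, Matrix.cons_val_one, Matrix.cons_val]
  linear_combination C u * hg

theorem InDCone.exists_dvd {A : Finset (Set (K × K))} (hA : IsLineArr A)
    {θ : Fin 3 → MvPolynomial (Fin 3) K} (h : InDCone A θ) :
    ∃ g, θ 2 = g * X 2 ∧ ∀ L ∈ A, (lineFrame L).form ∣
      (lineFrame L).normal (θ 0 - g * X 0, θ 1 - g * X 1) := by
  obtain ⟨g, hg⟩ := h.2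
  rw [applyDer3_X_two] at hg
  refine ⟨g, hg, fun L hL => ?_⟩
  obtain ⟨u, hu⟩ := h.1 L hL _ _ _ (lineFrame L).coeff_ne_zero (carrier_lineFrame (hA L hL)).symm
  refine ⟨u - g, ?_⟩
  rw [applyDer3_lin3, hg] at hu
  rw [LineFrame.normal_apply, LineFrame.form]
  simp only [lin3] at hu ⊢
  linear_combination hu

theorem sum_homogeneousComponent_of_totalDegree_le {σ : Type*} {p : MvPolynomial σ K} {n : ℕ}
    (h : p.totalDegree ≤ n) :
    ∑ i ∈ Finset.range (n + 1), homogeneousComponent i p = p := by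
  conv_rhs => rw [← sum_homogeneousComponent p]
  refine (Finset.sum_subset (Finset.range_mono (by omega)) fun i _ hi => ?_).symm
  rw [homogeneousComponent_eq_zero]
  simpa using hi

theorem homogeneousComponent_mem_logDer {A : Finset (Set (K × K))}
    {η : MvPolynomial (Fin 3) K × MvPolynomial (Fin 3) K}
    (h : ∀ L ∈ A, (lineFrame L).form ∣ (lineFrame L).normal η) (d : ℕ) :
    (homogeneousComponent d η.1, homogeneousComponent d η.2) ∈ logDer A d := by
  refine ⟨homogeneousComponent_isHomogeneous _ _, homogeneousComponent_isHomogeneous _ _,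
    fun L hL => ?_⟩
  have h1 := (lineFrame L).isHomogeneous_form.dvd_homogeneousComponent (h L hL) d
  rw [LineFrame.normal_apply, map_add, homogeneousComponent_C_mul,
    homogeneousComponent_C_mul] at h1
  exact h1

theorem isFreeExp_of_logDer {A : Finset (Set (K × K))} (hA : IsLineArr A) {d₁ d₂ : ℕ}
    {θ₁ θ₂ : MvPolynomial (Fin 3) K × MvPolynomial (Fin 3) K}
    (h₁ : θ₁ ∈ logDer A d₁) (h₂ : θ₂ ∈ logDer A d₂) (hdet : θ₁.1 * θ₂.2 - θ₁.2 * θ₂.1 ≠ 0)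
    (hgen : ∀ d, ∀ θ ∈ logDer A d, ∃ p₁ p₂ : MvPolynomial (Fin 3) K, θ = p₁ • θ₁ + p₂ • θ₂) :
    IsFreeExp A d₁ d₂ := by
  have hgen' : ∀ η : MvPolynomial (Fin 3) K × MvPolynomial (Fin 3) K,
      (∀ L ∈ A, (lineFrame L).form ∣ (lineFrame L).normal η) →
      ∃ p₁ p₂ : MvPolynomial (Fin 3) K, p₁ • θ₁ + p₂ • θ₂ = η := by
    intro η hη
    rw [← Submodule.mem_span_pair]
    have hsum : ∑ i ∈ Finset.range (max η.1.totalDegree η.2.totalDegree + 1),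
        (homogeneousComponent i η.1, homogeneousComponent i η.2) = η := by
      ext1
      · rw [Prod.fst_sum, sum_homogeneousComponent_of_totalDegree_le (le_max_left _ _)]
      · rw [Prod.snd_sum, sum_homogeneousComponent_of_totalDegree_le (le_max_right _ _)]
    rw [← hsum]
    refine Submodule.sum_mem _ fun i _ => ?_
    obtain ⟨p₁, p₂, h⟩ := hgen i _ (homogeneousComponent_mem_logDer hη i)
    exact Submodule.mem_span_pair.2 ⟨p₁, p₂, h.symm⟩
  refine ⟨![θ₁.1, θ₁.2, 0], ![θ₂.1, θ₂.2, 0], inDCone_of_dvd hA h₁.2.2, inDCone_of_dvd hA h₂.2.2,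
    ?_, ?_, fun θ hθ => ?_⟩
  · intro i
    fin_cases i
    · exact h₁.1
    · exact h₁.2.1
    · exact isHomogeneous_zero _ _ _
  · intro i
    fin_cases i
    · exact h₂.1
    · exact h₂.2.1
    · exact isHomogeneous_zero _ _ _
  obtain ⟨g, hg, hη⟩ := hθ.exists_dvd hA
  obtain ⟨p₁, p₂, hp⟩ := hgen' _ hη
  have hp1 := congrArg Prod.fst hp
  have hp2 := congrArg Prod.snd hp
  simp only [Prod.fst_add, Prod.snd_add, Prod.smul_fst, Prod.smul_snd, smul_eq_mul] at hp1 hp2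
  refine ⟨(g, p₁, p₂), ?_, ?_⟩
  · funext i
    fin_cases i
    · simp
      linear_combination -hp1
    · simp
      linear_combination -hp2
    · simpa using hg
  · rintro ⟨c, q₁, q₂⟩ hc
    have hc0 := congrFun hc 0
    have hc1 := congrFun hc 1
    have hc2 := congrFun hc 2
    simp only [Matrix.cons_val_zero, Matrix.cons_val_one, Matrix.cons_val, mul_zero,
      add_zero] at hc0 hc1 hc2
    have hcg : c = g := by
      rw [hg] at hc2
      exact (mul_right_cancel₀ (X_ne_zero 2) hc2).symm
    subst hcg
    have e1 : (q₁ - p₁) * (θ₁.1 * θ₂.2 - θ₁.2 * θ₂.1) = 0 := by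
      linear_combination θ₂.2 * (-hc0 - hp1) - θ₂.1 * (-hc1 - hp2)
    have e2 : (q₂ - p₂) * (θ₁.1 * θ₂.2 - θ₁.2 * θ₂.1) = 0 := by
      linear_combination θ₁.1 * (-hc1 - hp2) - θ₁.2 * (-hc0 - hp1)
    rw [sub_eq_zero.1 ((mul_eq_zero.1 e1).resolve_right hdet),
      sub_eq_zero.1 ((mul_eq_zero.1 e2).resolve_right hdet)]

theorem isFree_of_b2_eq {A : Finset (Set (K × K))} {H : Set (K × K)} (hA : IsLineArr A)
    (hH : IsAffineLine H) (hHA : H ∉ A)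
    (hb : b2 (Finset.cons H A hHA) = nOn A H * (A.card + 1 - nOn A H)) :
    IsFree (Finset.cons H A hHA) := by
  have hcons : IsLineArr (Finset.cons H A hHA) := by
    intro L hL
    rcases Finset.mem_cons.1 hL with rfl | hL
    · exact hH
    · exact hA L hL
  obtain ⟨⟨θ₁, h₁, h₁'⟩, θ₂, h₂, h₂'⟩ :=
    exists_tangentRes_ne_zero_and_normalRes_ne_zero hA hH hHA hb
  exact ⟨_, _, isFreeExp_of_logDer hcons h₁ (form_smul_mem_logDer hHA h₂)
    (det_ne_zero_of_res_ne_zero hHA h₁ h₁' h₂')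
    fun d θ hθ => exists_eq_smul_add_smul hA hH hHA h₁ h₂ h₁' h₂' hθ⟩

theorem sub_mem_logDer {A : Finset (Set (K × K))} {d : ℕ} {θ : Fin 3 → MvPolynomial (Fin 3) K}
    (hd : HomogDer3 θ d) {g : MvPolynomial (Fin 3) K} (hg : θ 2 = g * X 2)
    (h : ∀ L ∈ A, (lineFrame L).form ∣ (lineFrame L).normal (θ 0 - g * X 0, θ 1 - g * X 1)) :
    (θ 0 - g * X 0, θ 1 - g * X 1) ∈ logDer A d := by
  have hX := hd 2
  rw [hg, mul_comm] at hX
  have hgX : ∀ i, (g * X i).IsHomogeneous d := by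
    intro i
    rcases d with _ | e
    · have h0 := (isHomogeneous_X K (2 : Fin 3)).eq_zero_of_mul_of_lt hX one_pos
      rw [(mul_eq_zero.1 h0).resolve_left (X_ne_zero 2), zero_mul]
      exact isHomogeneous_zero _ _ _
    · exact ((isHomogeneous_X K (2 : Fin 3)).of_mul_left (X_ne_zero 2) hX).mul
        (isHomogeneous_X K i)
  exact ⟨(hd 0).sub (hgX 0), (hd 1).sub (hgX 1), h⟩

theorem IsFreeExp.exists_logDer {A : Finset (Set (K × K))} (hA : IsLineArr A) {d₁ d₂ : ℕ}
    (h : IsFreeExp A d₁ d₂) : ∃ η₁ ∈ logDer A d₁, ∃ η₂ ∈ logDer A d₂,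
      (∀ p₁ p₂ : MvPolynomial (Fin 3) K, p₁ • η₁ + p₂ • η₂ = 0 → p₁ = 0 ∧ p₂ = 0) ∧
      ∀ d, ∀ θ ∈ logDer A d, ∃ p₁ p₂ : MvPolynomial (Fin 3) K, θ = p₁ • η₁ + p₂ • η₂ := by
  obtain ⟨θ₁, θ₂, h₁, h₂, hd₁, hd₂, hbasis⟩ := h
  obtain ⟨g₁, hg₁, hη₁⟩ := h₁.exists_dvd hA
  obtain ⟨g₂, hg₂, hη₂⟩ := h₂.exists_dvd hA
  refine ⟨_, sub_mem_logDer hd₁ hg₁ hη₁, _, sub_mem_logDer hd₂ hg₂ hη₂, ?_, ?_⟩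
  · intro p₁ p₂ hp
    have hp1 := congrArg Prod.fst hp
    have hp2 := congrArg Prod.snd hp
    simp only [Prod.fst_add, Prod.snd_add, Prod.smul_fst, Prod.smul_snd, smul_eq_mul,
      Prod.fst_zero, Prod.snd_zero] at hp1 hp2
    have h0 : InDCone A (0 : Fin 3 → MvPolynomial (Fin 3) K) :=
      ⟨fun L _ a b c _ _ => ⟨0, by simp [applyDer3]⟩, 0, by simp [applyDer3]⟩
    have := (hbasis 0 h0).unique (y₁ := (-(p₁ * g₁ + p₂ * g₂), p₁, p₂)) (y₂ := (0, 0, 0)) (by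
      funext i
      fin_cases i
      · simp
        linear_combination -hp1
      · simp
        linear_combination -hp2
      · simp [hg₁, hg₂]
        ring) (by
      funext i
      simp)
    simp only [Prod.mk.injEq] at this
    exact this.2
  · intro d θ hθ
    obtain ⟨⟨c, p₁, p₂⟩, hc, -⟩ := hbasis _ (inDCone_of_dvd hA hθ.2.2)
    have hc0 := congrFun hc 0
    have hc1 := congrFun hc 1
    have hc2 := congrFun hc 2
    simp only [Matrix.cons_val_zero, Matrix.cons_val_one, Matrix.cons_val, hg₁, hg₂]
      at hc0 hc1 hc2
    have hc' : c = -(p₁ * g₁ + p₂ * g₂) := by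
      apply mul_right_cancel₀ (X_ne_zero (R := K) (2 : Fin 3))
      linear_combination -hc2
    refine ⟨p₁, p₂, Prod.ext ?_ ?_⟩
    · simp only [Prod.fst_add, Prod.smul_fst, smul_eq_mul]
      rw [hc0, hc']
      ring
    · simp only [Prod.snd_add, Prod.smul_snd, smul_eq_mul]
      rw [hc1, hc']
      ring

theorem finrank_logDer_of_basis {A : Finset (Set (K × K))} {d₁ d₂ : ℕ}
    {η₁ η₂ : MvPolynomial (Fin 3) K × MvPolynomial (Fin 3) K}
    (h₁ : η₁ ∈ logDer A d₁) (h₂ : η₂ ∈ logDer A d₂)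
    (hind : ∀ p₁ p₂ : MvPolynomial (Fin 3) K, p₁ • η₁ + p₂ • η₂ = 0 → p₁ = 0 ∧ p₂ = 0)
    (hgen : ∀ d, ∀ θ ∈ logDer A d, ∃ p₁ p₂ : MvPolynomial (Fin 3) K, θ = p₁ • η₁ + p₂ • η₂)
    (i j d : ℕ) (hi : i + d₁ = d) (hj : j + d₂ = d) :
    Module.finrank K (logDer A d) = (i + 2).choose 2 + (j + 2).choose 2 := by
  let Φ : homogeneousSubmodule (Fin 3) K i × homogeneousSubmodule (Fin 3) K j →ₗ[K]
      MvPolynomial (Fin 3) K × MvPolynomial (Fin 3) K :=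
    (((LinearMap.toSpanSingleton (MvPolynomial (Fin 3) K) _ η₁).restrictScalars K).domRestrict
      (homogeneousSubmodule (Fin 3) K i)).coprod
    (((LinearMap.toSpanSingleton (MvPolynomial (Fin 3) K) _ η₂).restrictScalars K).domRestrict
      (homogeneousSubmodule (Fin 3) K j))
  have hΦ : ∀ p, Φ p = (p.1 : MvPolynomial (Fin 3) K) • η₁ + (p.2 : MvPolynomial (Fin 3) K) • η₂ :=
    fun p => rfl
  have hinj : Function.Injective Φ := by
    rw [← LinearMap.ker_eq_bot, LinearMap.ker_eq_bot']
    intro p hp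
    obtain ⟨h1, h2⟩ := hind _ _ ((hΦ p).symm.trans hp)
    exact Prod.ext (Subtype.ext h1) (Subtype.ext h2)
  have hrange : LinearMap.range Φ = logDer A d := by
    apply le_antisymm
    · rintro _ ⟨p, rfl⟩
      rw [hΦ]
      refine add_mem ?_ ?_
      · rw [← hi]
        exact smul_mem_logDer p.1.2 h₁
      · rw [← hj]
        exact smul_mem_logDer p.2.2 h₂
    · intro θ hθ
      obtain ⟨p₁, p₂, hp⟩ := hgen d θ hθ
      refine ⟨(⟨homogeneousComponent i p₁, homogeneousComponent_isHomogeneous _ _⟩,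
        ⟨homogeneousComponent j p₂, homogeneousComponent_isHomogeneous _ _⟩), ?_⟩
      rw [hΦ]
      have key : ∀ {f a b : MvPolynomial (Fin 3) K}, f.IsHomogeneous d → a.IsHomogeneous d₁ →
          b.IsHomogeneous d₂ → f = p₁ * a + p₂ * b →
          homogeneousComponent i p₁ * a + homogeneousComponent j p₂ * b = f := by
        intro f a b hf ha hb h
        rw [← homogeneousComponent_eq_self hf, h, map_add, mul_comm p₁, mul_comm p₂]
        nth_rewrite 1 [← hi]
        rw [homogeneousComponent_mul_of_isHomogeneous ha, ← hj,
          homogeneousComponent_mul_of_isHomogeneous hb, mul_comm a, mul_comm b]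
      exact Prod.ext (key hθ.1 h₁.1 h₂.1 (congrArg Prod.fst hp))
        (key hθ.2.1 h₁.2.1 h₂.2.1 (congrArg Prod.snd hp))
  rw [← hrange, LinearMap.finrank_range_of_inj hinj, Module.finrank_prod,
    finrank_homogeneousSubmodule_fin_three, finrank_homogeneousSubmodule_fin_three]

theorem IsFreeExp.card_eq_and_b2_eq {A : Finset (Set (K × K))} (hA : IsLineArr A) {d₁ d₂ : ℕ}
    (h : IsFreeExp A d₁ d₂) : A.card = d₁ + d₂ ∧ b2 A = d₁ * d₂ := by
  obtain ⟨η₁, h₁, η₂, h₂, hind, hgen⟩ := h.exists_logDer hA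
  have hch : ∀ m : ℕ, 2 * ((m + 2).choose 2 : ℤ) = (m + 2) * (m + 1) := by
    intro m
    have h : (m + 2).choose 2 * 2 = (m + 2) * (m + 1) := by
      rw [Nat.choose_two_right, Nat.div_mul_cancel (Nat.even_mul_pred_self (m + 2)).two_dvd]
      rfl
    zify at h
    linarith
  have key : ∀ k : ℕ, (d₁ + d₂ - A.card : ℤ) * (2 * (A.card + d₁ + d₂ + k) + 3) =
      d₁ ^ 2 + d₂ ^ 2 - A.card ^ 2 + 2 * b2 A := by
    intro k
    have e1 := finrank_logDer_of_basis h₁ h₂ hind hgen (A.card + d₂ + k) (A.card + d₁ + k)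
      (A.card + d₁ + d₂ + k) (by ring) (by ring)
    have e2 := finrank_logDer_of_card_le hA (d := A.card + d₁ + d₂ + k) (by omega)
    have e3 := hch (A.card + d₂ + k)
    have e4 := hch (A.card + d₁ + k)
    rw [e1] at e2
    push_cast at e2 e3 e4
    linear_combination e3 + e4 - e2
  have k0 := key 0
  have k1 := key 1
  push_cast at k0 k1
  have hc : (d₁ + d₂ - A.card : ℤ) = 0 := by linarith
  have hc' : (A.card : ℤ) = d₁ + d₂ := by linarith
  refine ⟨by exact_mod_cast hc', ?_⟩
  rw [hc', sub_self, zero_mul] at k0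
  linarith

theorem nOn_cons (A : Finset (Set (K × K))) {H : Set (K × K)} (hHA : H ∉ A) :
    nOn (Finset.cons H A hHA) H = nOn A H := by
  rw [nOn, nOn]
  congr 1
  ext p
  simp only [Set.mem_ofPred_eq, Finset.mem_cons]
  constructor
  · rintro ⟨hp, L, rfl | hL, hne, hpL⟩
    · exact absurd rfl hne
    · exact ⟨hp, L, hL, hne, hpL⟩
  · rintro ⟨hp, L, hL, hne, hpL⟩
    exact ⟨hp, L, Or.inr hL, hne, hpL⟩

theorem exists_eq_cons {α : Type*} {A : Finset α} {H : α} (hH : H ∈ A) :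
    ∃ (A' : Finset α) (h : H ∉ A'), A = Finset.cons H A' h := by
  classical
  exact ⟨A.erase H, Finset.notMem_erase H A, by rw [Finset.cons_eq_insert, Finset.insert_erase hH]⟩

theorem nOn_mono {A B : Finset (Set (K × K))} {H : Set (K × K)} (hB : IsLineArr B)
    (hH : IsAffineLine H) (hHB : H ∉ B) (hAB : A ⊆ B) : nOn A H ≤ nOn B H := by
  rw [← card_meets hB hH hHB,
    ← card_meets (fun L hL => hB L (hAB hL)) hH fun h => hHB (hAB h)]
  refine Finset.card_le_card fun t ht => ?_
  obtain ⟨L, hL, h⟩ := mem_meets.1 ht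
  exact mem_meets.2 ⟨L, hAB hL, h⟩

/-- The number of points on a line of a free arrangement is at most the smaller exponent, or
equal to the larger one. -/
theorem IsFreeExp.nOn_le_min_or_eq_max {A : Finset (Set (K × K))} {H : Set (K × K)}
    (hA : IsLineArr A) (hH : IsAffineLine H) (hHA : H ∉ A) {d₁ d₂ : ℕ}
    (h : IsFreeExp (Finset.cons H A hHA) d₁ d₂) :
    nOn A H ≤ min d₁ d₂ ∨ nOn A H = max d₁ d₂ := by
  have hcons : IsLineArr (Finset.cons H A hHA) := by
    intro L hL
    rcases Finset.mem_cons.1 hL with rfl | hL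
    · exact hH
    · exact hA L hL
  have hcard := (h.card_eq_and_b2_eq hcons).1
  rw [Finset.card_cons] at hcard
  obtain ⟨η₁, h₁, η₂, h₂, hind, hgen⟩ := h.exists_logDer hcons
  have hle := nOn_le_card hA hH hHA
  by_contra! hcon
  obtain ⟨hmin, hmax⟩ := hcon
  rcases lt_or_gt_of_ne hmax with hlt | hgt
  · have hzero : ∀ d, d ≤ min d₁ d₂ →
        Module.finrank K (logDer (Finset.cons H A hHA) d) = 0 := by
      intro d
      induction d with
      | zero =>
        intro _
        have h3 := finrank_logDer_cons_le_inf_ker hA hH hHA 0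
        rw [finrank_inf_ker_tangentRes_zero hA hH hHA] at h3
        omega
      | succ d ih =>
        intro hd
        have h3 := finrank_logDer_cons_succ_le hA hH hHA d
        have h4 := finrank_logDer_le hA hH hHA d
        have h5 := ih (by omega)
        omega
    have hbot := fun d hd => Submodule.finrank_eq_zero.1 (hzero d hd)
    rcases le_total d₁ d₂ with hd | hd
    · rw [hbot d₁ (by omega), Submodule.mem_bot] at h₁
      exact one_ne_zero (hind 1 0 (by simp [h₁])).1
    · rw [hbot d₂ (by omega), Submodule.mem_bot] at h₂
      exact one_ne_zero (hind 0 1 (by simp [h₂])).2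
  · have hvan : ∀ {d : ℕ} {θ : MvPolynomial (Fin 3) K × MvPolynomial (Fin 3) K},
        θ ∈ logDer (Finset.cons H A hHA) d → d < nOn A H → (lineFrame H).tangentRes θ = 0 := by
      intro d θ hθ hd
      refine Polynomial.eq_zero_of_dvd_of_natDegree_lt (prod_dvd_tangentRes hHA hθ) ?_
      rw [natDegree_prod_meets hA hH hHA]
      exact ((lineFrame H).natDegree_res_le
        ((lineFrame H).isHomogeneous_tangent hθ.1 hθ.2.1)).trans_lt hd
    have h3 := hvan h₁ (by omega)
    have h4 := hvan h₂ (by omega)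
    have hall : logDer (Finset.cons H A hHA) (A.card + 1) ⊓
        LinearMap.ker (lineFrame H).tangentRes = logDer (Finset.cons H A hHA) (A.card + 1) := by
      refine inf_eq_left.2 fun θ hθ => ?_
      obtain ⟨p₁, p₂, rfl⟩ := hgen _ θ hθ
      rw [LinearMap.mem_ker, LineFrame.tangentRes_apply, map_add, map_smul, map_smul, map_add,
        smul_eq_mul, smul_eq_mul, map_mul, map_mul, ← LineFrame.tangentRes_apply,
        ← LineFrame.tangentRes_apply, h3, h4, mul_zero, mul_zero, add_zero]
    have h5 := finrank_inf_ker_tangentRes_succ hA hH hHA A.card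
    rw [hall] at h5
    have h6 := finrank_logDer_of_card_le hcons (d := A.card + 1) (by rw [Finset.card_cons])
    have h7 := finrank_logDer_of_card_le hA (d := A.card) le_rfl
    rw [b2_cons hA hH hHA, Finset.card_cons] at h6
    push_cast at h6
    zify at h5 hle
    linarith

theorem b2_le_of_subset {A B : Finset (Set (K × K))} (hA : IsLineArr A) (hBA : B ⊆ A) {m : ℕ}
    (hm : ∀ H ∈ A, nOn A H ≤ m) : b2 A ≤ b2 B + (A.card - B.card) * m := by
  classical
  have key : ∀ D : Finset (Set (K × K)), D ⊆ A \ B → b2 (B ∪ D) ≤ b2 B + D.card * m := by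
    intro D
    induction D using Finset.induction_on with
    | empty => simp
    | insert H D hHD ih =>
      intro hD
      have hH := Finset.mem_sdiff.1 (hD (Finset.mem_insert_self H D))
      have hDA : D ⊆ A \ B := (Finset.subset_insert H D).trans hD
      have hHBD : H ∉ B ∪ D := by
        simp [hH.2, hHD]
      have hBDA : B ∪ D ⊆ A := Finset.union_subset hBA (hDA.trans Finset.sdiff_subset)
      obtain ⟨A', hHA', rfl⟩ := exists_eq_cons hH.1
      have h1 : B ∪ D ⊆ A' := fun L hL =>
        (Finset.mem_cons.1 (hBDA hL)).resolve_left fun h => hHBD (h ▸ hL)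
      have h2 := nOn_mono (fun L hL => hA L (Finset.mem_cons_of_mem hL)) (hA H hH.1) hHA' h1
      have h3 := hm H hH.1
      rw [nOn_cons] at h3
      rw [Finset.union_insert, ← Finset.cons_eq_insert _ _ hHBD,
        b2_cons (fun L hL => hA L (hBDA hL)) (hA H hH.1), Finset.card_insert_of_notMem hHD]
      have h4 := ih hDA
      have h5 : (nOn (B ∪ D) H : ℤ) ≤ m := by exact_mod_cast h2.trans h3
      push_cast
      linarith
  have h := key (A \ B) subset_rfl
  rwa [Finset.union_sdiff_of_subset hBA, Finset.card_sdiff_of_subset hBA,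
    Nat.cast_sub (Finset.card_le_card hBA)] at h

theorem card_eq_and_b2_eq_of_chi {A : Finset (Set (K × K))} {n r : ℕ}
    (hchi : ∀ t : ℂ, chi A t = (t - (n : ℂ)) * (t - (n : ℂ) - (r : ℂ))) :
    A.card = 2 * n + r ∧ b2 A = n * (n + r) := by
  have h0 := hchi 0
  have h1 := hchi 1
  simp only [chi] at h0 h1
  have hb : (b2 A : ℂ) = n * (n + r) := by linear_combination h0
  have hc : (A.card : ℂ) = 2 * n + r := by linear_combination h0 - h1
  exact ⟨by exact_mod_cast hc, by exact_mod_cast hb⟩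

/-- **Proposition 5.3 (1)**. Let `χ(A,t) = (t−n)(t−n−r)` with `r ≥ 2`, and assume `A`
contains a free subarrangement `B` with `exp₀(B) = (n−2, n−3)`. Then `A` is free iff
`n_H = n` or `n_H = n + r` for some `H ∈ A`. -/
theorem free_iff_exists_line_exp_n2_n3
    {K : Type*} [Field K] (A : Finset (Set (K × K))) (hA : IsLineArr A)
    (n r : ℕ) (hr : 2 ≤ r)
    (hchi : ∀ t : ℂ, chi A t = (t - (n : ℂ)) * (t - (n : ℂ) - (r : ℂ)))
    (B : Finset (Set (K × K))) (hBA : B ⊆ A)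
    (hBfree : IsFreeExpZ B ((n : ℤ) - 2) ((n : ℤ) - 3)) :
    IsFree A ↔ ∃ H ∈ A, nOn A H = n ∨ nOn A H = n + r := by
  obtain ⟨hcard, hb2⟩ := card_eq_and_b2_eq_of_chi hchi
  constructor
  · rintro ⟨d₁, d₂, hfree⟩
    by_contra! hcon
    obtain ⟨e₁, e₂, he₁, he₂, hB⟩ := hBfree
    obtain ⟨hBcard, hBb2⟩ := hB.card_eq_and_b2_eq fun L hL => hA L (hBA hL)
    obtain ⟨hd, hdb⟩ := hfree.card_eq_and_b2_eq hA
    rw [hcard] at hd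
    rw [hb2] at hdb
    have hroot : ((d₁ : ℤ) - n) * (d₁ - (n + r)) = 0 := by
      have hd' : (2 * n + r : ℤ) = d₁ + d₂ := by exact_mod_cast hd
      linear_combination hdb - (d₁ : ℤ) * hd'
    have hminmax : min d₁ d₂ = n ∧ max d₁ d₂ = n + r := by
      rcases mul_eq_zero.1 hroot with h | h <;> omega
    have hbound : ∀ H ∈ A, nOn A H ≤ n - 1 := by
      intro H hH
      obtain ⟨hn, hnr⟩ := hcon H hH
      obtain ⟨A', hHA', rfl⟩ := exists_eq_cons hH
      rw [nOn_cons] at hn hnr ⊢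
      have h := hfree.nOn_le_min_or_eq_max (fun L hL => hA L (Finset.mem_cons_of_mem hL))
        (hA H hH) hHA'
      omega
    have h := b2_le_of_subset hA hBA hbound
    rw [hb2, hBb2, hcard, hBcard, Nat.cast_sub (by omega)] at h
    push_cast at h
    rw [he₁, he₂] at h
    zify at hr
    linarith
  · rintro ⟨H, hH, hn⟩
    obtain ⟨A', hHA', rfl⟩ := exists_eq_cons hH
    refine isFree_of_b2_eq (fun L hL => hA L (Finset.mem_cons_of_mem hL)) (hA H hH) hHA' ?_
    rw [nOn_cons] at hn
    rw [Finset.card_cons] at hcard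
    have hcard' : (A'.card : ℤ) + 1 = 2 * n + r := by exact_mod_cast hcard
    rw [hb2, hcard']
    rcases hn with h | h <;> rw [h] <;> push_cast <;> ring
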